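/- Let M be a d-cluster tilting subcategory of a weakly idempotent complete exact category E. Then M is a Frobenius d-exact category (it has enough projectives and enough injectives with respect to its d-exact structure and the projective and injective objects coincide) if and only if E is a Frobenius exact category and M is a dℤ-cluster tilting subcategory of E, meaning Ext^i_E(X,Y) = 0 for all X, Y ∈ M and all i > 0 not divisible by d. -/

import Mathlib

open CategoryTheory CategoryTheory.Limits

universe v u v' u'

/-- The data of a class of conflations (kernel–cokernel pairs) on an additive category,
encoded as a class of short complexes. -/
class ExactCatStruct (E : Type u) [Category.{v} E] [Preadditive E] : Type (max u v) where
  conflation : Set (ShortComplex E)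

variable {E : Type u} [Category.{v} E] [Preadditive E]

/-- A morphism is an inflation if it occurs as the first map of a conflation. -/
def Inflation [ExactCatStruct E] {X Y : E} (f : X ⟶ Y) : Prop :=
  ∃ (Z : E) (g : Y ⟶ Z) (w : f ≫ g = 0), ShortComplex.mk f g w ∈ ExactCatStruct.conflation

/-- A morphism is a deflation if it occurs as the second map of a conflation. -/
def Deflation [ExactCatStruct E] {Y Z : E} (g : Y ⟶ Z) : Prop :=
  ∃ (X : E) (f : X ⟶ Y) (w : f ≫ g = 0), ShortComplex.mk f g w ∈ ExactCatStruct.conflation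

/-- The axioms of a Quillen exact category, for a given class of conflations. -/
class IsExactCat (E : Type u) [Category.{v} E] [Preadditive E] [ExactCatStruct E] : Prop where
  iso_closed : ∀ {S T : ShortComplex E}, (S ≅ T) →
    S ∈ ExactCatStruct.conflation (E := E) → T ∈ ExactCatStruct.conflation
  conf_kernel : ∀ S ∈ ExactCatStruct.conflation (E := E),
    Nonempty (IsLimit (KernelFork.ofι S.f S.zero))
  conf_cokernel : ∀ S ∈ ExactCatStruct.conflation (E := E),
    Nonempty (IsColimit (CokernelCofork.ofπ S.g S.zero))
  id_inflation : ∀ X : E, Inflation (𝟙 X)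
  id_deflation : ∀ X : E, Deflation (𝟙 X)
  comp_inflation : ∀ {X Y Z : E} (f : X ⟶ Y) (g : Y ⟶ Z),
    Inflation f → Inflation g → Inflation (f ≫ g)
  comp_deflation : ∀ {X Y Z : E} (f : X ⟶ Y) (g : Y ⟶ Z),
    Deflation f → Deflation g → Deflation (f ≫ g)
  pullback_deflation : ∀ {X Y Z : E} (p : Y ⟶ Z) (f : X ⟶ Z), Deflation p →
    ∃ (W : E) (f' : W ⟶ Y) (p' : W ⟶ X), Deflation p' ∧ IsPullback f' p' p f
  pushout_inflation : ∀ {X Y Z : E} (i : X ⟶ Y) (f : X ⟶ Z), Inflation i →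
    ∃ (W : E) (i' : Z ⟶ W) (g : Y ⟶ W), Inflation i' ∧ IsPushout i f g i'

/-- Weak idempotent completeness: every split epimorphism has a kernel. -/
def WeaklyIdemComplete (E : Type u) [Category.{v} E] [Preadditive E] : Prop :=
  ∀ ⦃X Y : E⦄ (f : X ⟶ Y), IsSplitEpi f → HasKernel f

variable (E) in
/-- An exact (acyclic) sequence `0 → Y → E_n → ⋯ → E_1 → X → 0` in an exact category,
with the factorization of its differentials through conflations as part of the data:
`Z i` is the splice object between `ob (i+1)` and `ob i`. -/
structure EExtSeq [ExactCatStruct E] (n : ℕ) (X Y : E) where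
  ob : ℕ → E
  Z : ℕ → E
  π : ∀ i, ob (i + 1) ⟶ Z i
  ι : ∀ i, Z i ⟶ ob i
  iso0 : ob 0 ≅ X
  isoTop : ob (n + 1) ≅ Y
  ob_zero : ∀ i, n + 1 < i → IsZero (ob i)
  Z_zero : ∀ i, n < i → IsZero (Z i)
  w : ∀ i, ι (i + 1) ≫ π i = 0
  confl : ∀ i, ShortComplex.mk (ι (i + 1)) (π i) (w i) ∈ ExactCatStruct.conflation
  iso_bot : IsIso (ι 0)

/-- The differentials of an acyclic sequence. -/
def EExtSeq.dd [ExactCatStruct E] {n : ℕ} {X Y : E} (s : EExtSeq E n X Y) (i : ℕ) :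
    s.ob (i + 1) ⟶ s.ob i :=
  s.π i ≫ s.ι i

lemma EExtSeq.dd_comp [ExactCatStruct E] {n : ℕ} {X Y : E} (s : EExtSeq E n X Y) (i : ℕ) :
    s.dd (i + 1) ≫ s.dd i = 0 := by
  show (s.π (i + 1) ≫ s.ι (i + 1)) ≫ s.π i ≫ s.ι i = 0
  rw [Category.assoc, ← Category.assoc (s.ι (i + 1)) (s.π i) (s.ι i), s.w i, zero_comp,
    comp_zero]

/-- A morphism of acyclic sequences inducing the identity on the end terms. -/
structure EExtSeqHom [ExactCatStruct E] {n : ℕ} {X Y : E} (s t : EExtSeq E n X Y) where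
  φ : ∀ i, s.ob i ⟶ t.ob i
  comm : ∀ i, s.dd i ≫ φ i = φ (i + 1) ≫ t.dd i
  φ0 : φ 0 = s.iso0.hom ≫ t.iso0.inv
  φTop : φ (n + 1) = s.isoTop.hom ≫ t.isoTop.inv

/-- Yoneda equivalence of `n`-fold extensions in an exact category. -/
def EYonedaEquiv [ExactCatStruct E] {n : ℕ} {X Y : E} :
    EExtSeq E n X Y → EExtSeq E n X Y → Prop :=
  Relation.EqvGen fun s t => Nonempty (EExtSeqHom s t)

variable (E) in
/-- Vanishing of the Yoneda Ext-group `Ext^n_E(X, Y)` of an exact category: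
all `n`-fold extensions of `X` by `Y` are Yoneda equivalent. -/
def eExtVanish [ExactCatStruct E] (n : ℕ) (X Y : E) : Prop :=
  ∀ s t : EExtSeq E n X Y, EYonedaEquiv s t

variable (E) in
/-- `ℳ` is a `d`-cluster tilting subcategory of the exact category `E`. -/
structure IsDCT [ExactCatStruct E] (ℳ : Set E) (d : ℕ) : Prop where
  iso_closed : ∀ X Y : E, (X ≅ Y) → X ∈ ℳ → Y ∈ ℳ
  generating : ∀ X : E, ∃ M ∈ ℳ, ∃ f : M ⟶ X, Deflation f
  cogenerating : ∀ X : E, ∃ M ∈ ℳ, ∃ f : X ⟶ M, Inflation f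
  contravariantly_finite : ∀ X : E, ∃ M ∈ ℳ, ∃ f : M ⟶ X,
    ∀ M' ∈ ℳ, ∀ g : M' ⟶ X, ∃ h : M' ⟶ M, h ≫ f = g
  covariantly_finite : ∀ X : E, ∃ M ∈ ℳ, ∃ f : X ⟶ M,
    ∀ M' ∈ ℳ, ∀ g : X ⟶ M', ∃ h : M ⟶ M', f ≫ h = g
  eq_left_perp : ℳ = {X : E | ∀ i, 0 < i → i < d → ∀ M ∈ ℳ, eExtVanish E i X M}
  eq_right_perp : ℳ = {X : E | ∀ i, 0 < i → i < d → ∀ M ∈ ℳ, eExtVanish E i M X}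

variable (E) in
/-- `f` is an admissible epimorphism of the `d`-exact structure on `ℳ`: it occurs as the
final differential of an admissible `d`-exact sequence of `ℳ` (a complex with `d + 2`
terms in `ℳ` that is acyclic in `E`). -/
def MAdmEpi [ExactCatStruct E] (ℳ : Set E) (d : ℕ) {X Y : E} (f : X ⟶ Y) : Prop :=
  ∃ (T : E) (s : EExtSeq E d Y T), (∀ i, i ≤ d + 1 → s.ob i ∈ ℳ) ∧
    ∃ e : s.ob 1 ≅ X, s.dd 0 = e.hom ≫ f ≫ s.iso0.inv

variable (E) in
/-- `f` is an admissible monomorphism of the `d`-exact structure on `ℳ`. -/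
def MAdmMono [ExactCatStruct E] (ℳ : Set E) (d : ℕ) {X Y : E} (f : X ⟶ Y) : Prop :=
  ∃ (B : E) (s : EExtSeq E d B X), (∀ i, i ≤ d + 1 → s.ob i ∈ ℳ) ∧
    ∃ e : s.ob d ≅ Y, s.dd d = s.isoTop.hom ≫ f ≫ e.inv

variable (E) in
/-- `P` is projective in the `d`-exact category `ℳ`. -/
def MProj [ExactCatStruct E] (ℳ : Set E) (d : ℕ) (P : E) : Prop :=
  ∀ ⦃X Y : E⦄ (f : X ⟶ Y), MAdmEpi E ℳ d f → ∀ g : P ⟶ Y, ∃ h : P ⟶ X, h ≫ f = g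

variable (E) in
/-- `I` is injective in the `d`-exact category `ℳ`. -/
def MInj [ExactCatStruct E] (ℳ : Set E) (d : ℕ) (I : E) : Prop :=
  ∀ ⦃X Y : E⦄ (f : X ⟶ Y), MAdmMono E ℳ d f → ∀ g : X ⟶ I, ∃ h : Y ⟶ I, f ≫ h = g

variable (E) in
/-- The `d`-exact category `ℳ` is Frobenius: it has enough projectives, enough
injectives, and projectives coincide with injectives. -/
def MFrobenius [ExactCatStruct E] (ℳ : Set E) (d : ℕ) : Prop :=
  (∀ M ∈ ℳ, ∃ (T : E) (s : EExtSeq E d M T), (∀ i, i ≤ d + 1 → s.ob i ∈ ℳ) ∧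
    ∀ i, 1 ≤ i → i ≤ d → MProj E ℳ d (s.ob i)) ∧
  (∀ M ∈ ℳ, ∃ (B : E) (s : EExtSeq E d B M), (∀ i, i ≤ d + 1 → s.ob i ∈ ℳ) ∧
    ∀ i, 1 ≤ i → i ≤ d → MInj E ℳ d (s.ob i)) ∧
  (∀ P ∈ ℳ, (MProj E ℳ d P ↔ MInj E ℳ d P))

variable (E) in
/-- `P` is projective in the exact category `E`. -/
def EProj [ExactCatStruct E] (P : E) : Prop :=
  ∀ ⦃X Y : E⦄ (f : X ⟶ Y), Deflation f → ∀ g : P ⟶ Y, ∃ h : P ⟶ X, h ≫ f = g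

variable (E) in
/-- `I` is injective in the exact category `E`. -/
def EInj [ExactCatStruct E] (I : E) : Prop :=
  ∀ ⦃X Y : E⦄ (f : X ⟶ Y), Inflation f → ∀ g : X ⟶ I, ∃ h : Y ⟶ I, f ≫ h = g

variable (E) in
/-- The exact category `E` is Frobenius. -/
def EFrobenius [ExactCatStruct E] : Prop :=
  (∀ X : E, ∃ P : E, EProj E P ∧ ∃ p : P ⟶ X, Deflation p) ∧
  (∀ X : E, ∃ I : E, EInj E I ∧ ∃ i : X ⟶ I, Inflation i) ∧
  (∀ P : E, EProj E P ↔ EInj E P)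


set_option linter.unusedSectionVars false

section Basics

variable [ExactCatStruct E]

/-- `A → B → C` is a conflation. -/
def Conf {A B C : E} (f : A ⟶ B) (g : B ⟶ C) : Prop :=
  ∃ w : f ≫ g = 0, ShortComplex.mk f g w ∈ ExactCatStruct.conflation

lemma Conf.w {A B C : E} {f : A ⟶ B} {g : B ⟶ C} (h : Conf f g) : f ≫ g = 0 := h.1

lemma Conf.defl {A B C : E} {f : A ⟶ B} {g : B ⟶ C} (h : Conf f g) : Deflation g :=
  ⟨A, f, h.1, h.2⟩

lemma Conf.infl {A B C : E} {f : A ⟶ B} {g : B ⟶ C} (h : Conf f g) : Inflation f :=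
  ⟨C, g, h.1, h.2⟩

lemma Deflation.conf {B C : E} {g : B ⟶ C} (h : Deflation g) :
    ∃ (A : E) (f : A ⟶ B), Conf f g := by
  obtain ⟨A, f, w, hc⟩ := h
  exact ⟨A, f, w, hc⟩

lemma Inflation.conf {A B : E} {f : A ⟶ B} (h : Inflation f) :
    ∃ (C : E) (g : B ⟶ C), Conf f g := by
  obtain ⟨A, f, w, hc⟩ := h
  exact ⟨A, f, w, hc⟩

variable [IsExactCat E]

lemma Conf.lift {A B C : E} {f : A ⟶ B} {g : B ⟶ C} (h : Conf f g) {T : E} (k : T ⟶ B)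
    (hk : k ≫ g = 0) : ∃ l : T ⟶ A, l ≫ f = k := by
  obtain ⟨w, hc⟩ := h
  obtain ⟨hl⟩ := IsExactCat.conf_kernel _ hc
  obtain ⟨l, hl'⟩ := KernelFork.IsLimit.lift' hl k hk
  exact ⟨l, hl'⟩

lemma Conf.desc {A B C : E} {f : A ⟶ B} {g : B ⟶ C} (h : Conf f g) {T : E} (k : B ⟶ T)
    (hk : f ≫ k = 0) : ∃ l : C ⟶ T, g ≫ l = k := by
  obtain ⟨w, hc⟩ := h
  obtain ⟨hl⟩ := IsExactCat.conf_cokernel _ hc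
  obtain ⟨l, hl'⟩ := CokernelCofork.IsColimit.desc' hl k hk
  exact ⟨l, hl'⟩

lemma Conf.mono {A B C : E} {f : A ⟶ B} {g : B ⟶ C} (h : Conf f g) : Mono f := by
  obtain ⟨w, hc⟩ := h
  obtain ⟨hl⟩ := IsExactCat.conf_kernel _ hc
  exact mono_of_isLimit_fork hl

lemma Conf.epi {A B C : E} {f : A ⟶ B} {g : B ⟶ C} (h : Conf f g) : Epi g := by
  obtain ⟨w, hc⟩ := h
  obtain ⟨hl⟩ := IsExactCat.conf_cokernel _ hc
  exact epi_of_isColimit_cofork hl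

lemma Conf.of_iso {A B C A' B' C' : E} {f : A ⟶ B} {g : B ⟶ C} (h : Conf f g)
    {f' : A' ⟶ B'} {g' : B' ⟶ C'} (a : A ≅ A') (b : B ≅ B') (c : C ≅ C')
    (h1 : a.hom ≫ f' = f ≫ b.hom) (h2 : b.hom ≫ g' = g ≫ c.hom) : Conf f' g' := by
  have w' : f' ≫ g' = 0 := by
    rw [← cancel_epi a.hom, ← Category.assoc, h1, Category.assoc, h2, ← Category.assoc, h.w]
    simp
  exact ⟨w', IsExactCat.iso_closed (ShortComplex.isoMk a b c h1 h2) h.2⟩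

/-- A deflation together with a weak kernel which is mono is a conflation. -/
lemma Deflation.conf_of {A B C : E} {f : A ⟶ B} {g : B ⟶ C} (h : Deflation g) (hm : Mono f)
    (w : f ≫ g = 0) (hl : ∀ {T : E} (k : T ⟶ B), k ≫ g = 0 → ∃ l : T ⟶ A, l ≫ f = k) :
    Conf f g := by
  obtain ⟨A', f', hc⟩ := h.conf
  obtain ⟨l, hl1⟩ := hl f' hc.w
  obtain ⟨m, hm1⟩ := hc.lift f w
  have := hc.mono
  refine hc.of_iso ⟨l, m, ?_, ?_⟩ (Iso.refl _) (Iso.refl _) ?_ ?_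
  · rw [← cancel_mono f', Category.assoc, hm1, hl1, Category.id_comp]
  · rw [← cancel_mono f, Category.assoc, hl1, hm1, Category.id_comp]
  · simp [hl1]
  · simp

lemma Inflation.conf_of {A B C : E} {f : A ⟶ B} {g : B ⟶ C} (h : Inflation f) (hm : Epi g)
    (w : f ≫ g = 0) (hl : ∀ {T : E} (k : B ⟶ T), f ≫ k = 0 → ∃ l : C ⟶ T, g ≫ l = k) :
    Conf f g := by
  obtain ⟨C', g', hc⟩ := h.conf
  obtain ⟨l, hl1⟩ := hl g' hc.w
  obtain ⟨m, hm1⟩ := hc.desc g w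
  have := hc.epi
  refine hc.of_iso (Iso.refl _) (Iso.refl _) ⟨m, l, ?_, ?_⟩ ?_ ?_
  · rw [← cancel_epi g', ← Category.assoc, hm1, hl1, Category.comp_id]
  · rw [← cancel_epi g, ← Category.assoc, hl1, hm1, Category.comp_id]
  · simp
  · simp [hm1]

/-- Pullback of a conflation. -/
lemma Conf.pull {A B C : E} {i : A ⟶ B} {p : B ⟶ C} (h : Conf i p) {X : E} (g : X ⟶ C) :
    ∃ (W : E) (i' : A ⟶ W) (p' : W ⟶ X) (q : W ⟶ B), Conf i' p' ∧ i' ≫ q = i ∧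
      IsPullback q p' p g := by
  obtain ⟨W, q, p', hp', hpb⟩ := IsExactCat.pullback_deflation p g h.defl
  have hw : i ≫ p = (0 : A ⟶ X) ≫ g := by rw [h.w, zero_comp]
  refine ⟨W, hpb.lift i 0 hw, p', q, ?_, by simp, hpb⟩
  have hq : hpb.lift i 0 hw ≫ q = i := by simp
  have := h.mono
  have hm : Mono (hpb.lift i 0 hw) := by
    have : Mono (hpb.lift i 0 hw ≫ q) := by rw [hq]; infer_instance
    exact mono_of_mono _ q
  refine hp'.conf_of hm (by simp) ?_
  intro T k hk
  obtain ⟨l, hl⟩ := h.lift (k ≫ q) (by rw [Category.assoc, hpb.w, ← Category.assoc, hk, zero_comp])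
  refine ⟨l, hpb.hom_ext ?_ ?_⟩
  · rw [Category.assoc, hq, hl]
  · simp [hk]

/-- Pushout of a conflation. -/
lemma Conf.push {A B C : E} {i : A ⟶ B} {p : B ⟶ C} (h : Conf i p) {Y : E} (f : A ⟶ Y) :
    ∃ (W : E) (i' : Y ⟶ W) (p' : W ⟶ C) (q : B ⟶ W), Conf i' p' ∧ q ≫ p' = p ∧
      IsPushout i f q i' := by
  obtain ⟨W, i', q, hi', hpo⟩ := IsExactCat.pushout_inflation i f h.infl
  have hw : i ≫ p = f ≫ (0 : Y ⟶ C) := by rw [h.w, comp_zero]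
  refine ⟨W, i', hpo.desc p 0 hw, q, ?_, by simp, hpo⟩
  have hq : q ≫ hpo.desc p 0 hw = p := by simp
  have := h.epi
  have hm : Epi (hpo.desc p 0 hw) := by
    have : Epi (q ≫ hpo.desc p 0 hw) := by rw [hq]; infer_instance
    exact epi_of_epi q _
  refine hi'.conf_of hm (by simp) ?_
  intro T k hk
  obtain ⟨l, hl⟩ := h.desc (q ≫ k) (by rw [← Category.assoc, hpo.w, Category.assoc, hk, comp_zero])
  refine ⟨l, hpo.hom_ext ?_ ?_⟩
  · rw [← Category.assoc, hq, hl]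
  · simp [hk]

lemma Conf.comp_defl {A B C D : E} {i : A ⟶ B} {p : B ⟶ C} (h : Conf i p) {q : C ⟶ D}
    (hq : Deflation q) : ∃ (K : E) (j : K ⟶ B), Conf j (p ≫ q) :=
  (IsExactCat.comp_deflation p q h.defl hq).conf

lemma conf_zero_id {O : E} (hO : IsZero O) (X : E) : Conf (0 : O ⟶ X) (𝟙 X) := by
  refine (IsExactCat.id_deflation X).conf_of ⟨fun _ _ _ => hO.eq_of_tgt _ _⟩ (by simp) ?_
  intro T k hk
  exact ⟨0, by simpa using hk.symm⟩

lemma conf_id_zero {O : E} (hO : IsZero O) (X : E) : Conf (𝟙 X) (0 : X ⟶ O) := by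
  refine (IsExactCat.id_inflation X).conf_of ⟨fun _ _ _ => hO.eq_of_src _ _⟩ (by simp) ?_
  intro T k hk
  exact ⟨0, by simpa using hk.symm⟩

lemma Conf.precomp_iso {A B C B' : E} {i : A ⟶ B} {p : B ⟶ C} (h : Conf i p) (e : B' ≅ B) :
    Conf (i ≫ e.inv) (e.hom ≫ p) :=
  h.of_iso (Iso.refl _) e.symm (Iso.refl _) (by simp) (by simp)

lemma Conf.right_iso {A B C C' : E} {i : A ⟶ B} {p : B ⟶ C} (h : Conf i p) (e : C ≅ C') :
    Conf i (p ≫ e.hom) :=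
  h.of_iso (Iso.refl _) (Iso.refl _) e (by simp) (by simp)

lemma Conf.left_iso {A B C A' : E} {i : A ⟶ B} {p : B ⟶ C} (h : Conf i p) (e : A' ≅ A) :
    Conf (e.hom ≫ i) p :=
  h.of_iso e.symm (Iso.refl _) (Iso.refl _) (by simp) (by simp)

lemma Conf.isIso_of_zero {A B C : E} {i : A ⟶ B} {p : B ⟶ C} (h : Conf i p) (hA : IsZero A) :
    IsIso p := by
  obtain ⟨r, hr⟩ := h.desc (𝟙 B) (hA.eq_of_src _ _)
  have := h.epi
  refine ⟨r, hr, ?_⟩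
  rw [← cancel_epi p, ← Category.assoc, hr]; simp

variable [HasZeroObject E] [HasBinaryBiproducts E]

open ZeroObject

lemma conf_biprod (A B : E) : Conf (biprod.inl : A ⟶ A ⊞ B) (biprod.snd : A ⊞ B ⟶ B) := by
  have hz : IsZero (0 : E) := isZero_zero E
  obtain ⟨W, i', p', q, hc, hq, hpo⟩ := (conf_zero_id hz B).push (0 : (0 : E) ⟶ A)
  have e1 : i' ≫ hpo.desc biprod.inr biprod.inl (by simp) = (biprod.inl : A ⟶ A ⊞ B) := by simp
  refine hc.of_iso (Iso.refl _)
    ⟨hpo.desc biprod.inr biprod.inl (by simp), biprod.desc i' q, ?_, ?_⟩ (Iso.refl _) ?_ ?_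
  · apply hpo.hom_ext <;> simp
  · apply biprod.hom_ext' <;> simp
  · simp
  · apply hpo.hom_ext <;> simp [hq, hc.w]

/-- `[f, g]` is a deflation if `g` is. -/
lemma deflation_desc {A B X : E} (f : A ⟶ X) {g : B ⟶ X} (hg : Deflation g) :
    Deflation (biprod.desc f g) := by
  obtain ⟨K, i, hc⟩ := hg.conf
  obtain ⟨W, i', p', q, hc', hi', hpb⟩ := hc.pull (biprod.desc (-f) (𝟙 X) : A ⊞ X ⟶ X)
  let e1 : A ⊞ B ⟶ W := hpb.lift (biprod.snd)
    (biprod.lift biprod.fst (biprod.snd ≫ g + biprod.fst ≫ f)) (by simp)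
  let e2 : W ⟶ A ⊞ B := biprod.lift (p' ≫ biprod.fst) q
  have h12 : e1 ≫ e2 = 𝟙 _ := by
    apply biprod.hom_ext <;> simp [e1, e2]
  have h21 : e2 ≫ e1 = 𝟙 _ := by
    apply hpb.hom_ext
    · simp [e1, e2]
    · apply biprod.hom_ext
      · simp [e1, e2]
      · simp [e1, e2, hpb.w, biprod.desc_eq]
  have h3 : Deflation (p' ≫ (biprod.snd : A ⊞ X ⟶ X)) :=
    IsExactCat.comp_deflation _ _ hc'.defl (conf_biprod A X).defl
  obtain ⟨K3, i3, hc3⟩ := h3.conf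
  have h4 := (hc3.precomp_iso ⟨e1, e2, h12, h21⟩).defl
  have h5 : e1 ≫ p' ≫ biprod.snd = biprod.desc f g := by
    simp only [e1]
    apply biprod.hom_ext' <;> simp
  rw [← h5]
  exact h4

end Basics

section Towers

variable [ExactCatStruct E]

/-- Towers of conflations: `Tw Y n X` consists of `(n+1)`-fold extensions of `X` by `Y`. -/
inductive Tw (Y : E) : ℕ → E → Type (max u v)
  | base {A X : E} (i : Y ⟶ A) (p : A ⟶ X) (h : Conf i p) : Tw Y 0 X
  | step {n : ℕ} {K A X : E} (i : K ⟶ A) (p : A ⟶ X) (h : Conf i p) (t : Tw Y n K) :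
      Tw Y (n + 1) X

/-- `Eff t g` : the pullback of the extension `t` along `g` is trivial. -/
def Eff {Y : E} : ∀ {n : ℕ} {W : E}, Tw Y n W → ∀ {X : E}, (X ⟶ W) → Prop
  | _, _, .base (A := A) _ p _, X, g => ∃ l : X ⟶ A, l ≫ p = g
  | _, _, .step (K := K) (A := A) i p _ t, X, g =>
      ∃ (K' E' : E) (i' : K' ⟶ E') (p' : E' ⟶ X) (e : E' ⟶ A) (k : K' ⟶ K),
        Conf i' p' ∧ i' ≫ e = k ≫ i ∧ e ≫ p = p' ≫ g ∧ Eff t k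

/-- Morphisms of towers. -/
inductive TMor {Y Y' : E} (b : Y ⟶ Y') :
    ∀ {n : ℕ} {W W' : E}, Tw Y n W → Tw Y' n W' → (W ⟶ W') → Prop
  | base {A X A' X' : E} (i : Y ⟶ A) (p : A ⟶ X) (h : Conf i p) (i' : Y' ⟶ A') (p' : A' ⟶ X')
      (h' : Conf i' p') (g : X ⟶ X') (e : A ⟶ A') (h1 : i ≫ e = b ≫ i') (h2 : e ≫ p' = p ≫ g) :
      TMor b (.base i p h) (.base i' p' h') g
  | step {n : ℕ} {K A X K' A' X' : E} (i : K ⟶ A) (p : A ⟶ X) (h : Conf i p) (i' : K' ⟶ A')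
      (p' : A' ⟶ X') (h' : Conf i' p') (g : X ⟶ X') (e : A ⟶ A') (k : K ⟶ K')
      (t : Tw Y n K) (t' : Tw Y' n K')
      (h1 : i ≫ e = k ≫ i') (h2 : e ≫ p' = p ≫ g) (hk : TMor b t t' k) :
      TMor b (.step i p h t) (.step i' p' h' t') g

/-- Vanishing of `Ext^{n+1}(X, Y)`, in terms of towers. -/
def V (n : ℕ) (X Y : E) : Prop :=
  ∀ (W : E) (t : Tw Y n W) (g : X ⟶ W), Eff t g

variable [IsExactCat E]

lemma Conf.induced {K A X K' A' X' : E} {i : K ⟶ A} {p : A ⟶ X} (h : Conf i p)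
    {i' : K' ⟶ A'} {p' : A' ⟶ X'} (h' : Conf i' p') {g : X ⟶ X'} {e : A ⟶ A'}
    (he : e ≫ p' = p ≫ g) : ∃ k : K ⟶ K', i ≫ e = k ≫ i' := by
  obtain ⟨l, hl⟩ := h'.lift (i ≫ e) (by
    rw [Category.assoc, he, ← Category.assoc, h.w, zero_comp])
  exact ⟨l, hl.symm⟩

lemma Conf.refine {K A X A' : E} {i : K ⟶ A} {p : A ⟶ X} (h : Conf i p) {q : A' ⟶ A}
    (hq : Deflation q) : ∃ (K' : E) (i' : K' ⟶ A') (k : K' ⟶ K), Conf i' (q ≫ p) ∧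
      i' ≫ q = k ≫ i := by
  obtain ⟨K', i', hc⟩ := (IsExactCat.comp_deflation q p hq h.defl).conf
  obtain ⟨k, hk⟩ := hc.induced h (g := 𝟙 X) (e := q) (by simp)
  exact ⟨K', i', k, hc, hk⟩

/-- Fibre product of two conflations over the same object. -/
lemma Conf.fiber {X K1 E1 K2 E2 : E} {i1 : K1 ⟶ E1} {p1 : E1 ⟶ X} (h1 : Conf i1 p1)
    {i2 : K2 ⟶ E2} {p2 : E2 ⟶ X} (h2 : Conf i2 p2) :
    ∃ (K F : E) (i : K ⟶ F) (a : F ⟶ E1) (b : F ⟶ E2) (k1 : K ⟶ K1) (k2 : K ⟶ K2),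
      Conf i (b ≫ p2) ∧ Deflation b ∧ a ≫ p1 = b ≫ p2 ∧ i ≫ a = k1 ≫ i1 ∧ i ≫ b = k2 ≫ i2 := by
  obtain ⟨F, i', b, a, hc, _, hpb⟩ := h1.pull p2
  obtain ⟨K, i, k2, hc2, hk2⟩ := h2.refine hc.defl
  obtain ⟨k1, hk1⟩ := hc2.induced h1 (g := 𝟙 X) (e := a) (by simp [hpb.w])
  exact ⟨K, F, i, a, b, k1, k2, hc2, hc.defl, hpb.w, hk1, hk2⟩

/-- Restriction of trivialisations. -/
lemma Eff.precomp {Y : E} {n : ℕ} {W : E} (t : Tw Y n W) {X X' : E} {g : X ⟶ W} (hg : Eff t g)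
    (h : X' ⟶ X) : Eff t (h ≫ g) := by
  cases t with
  | base i p hc =>
    obtain ⟨l, hl⟩ := hg
    exact ⟨h ≫ l, by rw [Category.assoc, hl]⟩
  | step i p hc t =>
    obtain ⟨K', E', i', p', e, k, hc', h1, h2, h3⟩ := hg
    obtain ⟨F, i'', p'', q, hc'', hi'', hpb⟩ := hc'.pull h
    refine ⟨K', F, i'', p'', q ≫ e, k, hc'', ?_, ?_, h3⟩
    · rw [← Category.assoc, hi'', h1]
    · rw [Category.assoc, h2, ← Category.assoc, hpb.w, Category.assoc]

/-- Sums of trivialisations. -/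
lemma Eff.add {Y : E} {n : ℕ} {W : E} (t : Tw Y n W) : ∀ {X : E} {g g' : X ⟶ W}, Eff t g →
    Eff t g' → Eff t (g + g') := by
  induction t with
  | base i p hc =>
    rintro X g g' ⟨l, hl⟩ ⟨l', hl'⟩
    exact ⟨l + l', by simp [hl, hl']⟩
  | step i p hc t ih =>
    rintro X g g' ⟨K1, E1, i1, p1, e1, k1, hc1, h1, h1', h1''⟩
      ⟨K2, E2, i2, p2, e2, k2, hc2, h2, h2', h2''⟩
    obtain ⟨K, F, j, a, b, κ1, κ2, hcF, hb, hab, hκ1, hκ2⟩ := hc1.fiber hc2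
    refine ⟨K, F, j, b ≫ p2, a ≫ e1 + b ≫ e2, κ1 ≫ k1 + κ2 ≫ k2, hcF, ?_, ?_, ?_⟩
    · simp only [Preadditive.comp_add, Preadditive.add_comp, Category.assoc, ← h1, ← h2]
      rw [← Category.assoc, hκ1, ← Category.assoc j, hκ2]
      simp only [Category.assoc]
    · simp only [Preadditive.comp_add, Preadditive.add_comp, Category.assoc, h1', h2']
      rw [← Category.assoc a, hab, Category.assoc]
    · exact ih (h1''.precomp _ _) (h2''.precomp _ _)

variable [HasZeroObject E]

open ZeroObject

lemma Eff.zero {Y : E} {n : ℕ} {W : E} (t : Tw Y n W) (X : E) : Eff t (0 : X ⟶ W) := by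
  induction t generalizing X with
  | base i p hc => exact ⟨0, by simp⟩
  | step i p hc t ih =>
    exact ⟨0, X, 0, 𝟙 X, 0, 0, conf_zero_id (isZero_zero E) X, by simp, by simp, ih _⟩

/-- Maps factoring through the first deflation trivialise a tower. -/
lemma Eff.step_of_lift {Y : E} {n : ℕ} {K A W : E} {i : K ⟶ A} {p : A ⟶ W} {hc : Conf i p}
    {t : Tw Y n K} {X : E} (l : X ⟶ A) : Eff (Tw.step i p hc t) (l ≫ p) :=
  ⟨0, X, 0, 𝟙 X, l, 0, conf_zero_id (isZero_zero E) X, by simp, by simp, Eff.zero _ _⟩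

lemma Tw.efface {Y : E} {n : ℕ} {W : E} (t : Tw Y n W) {X : E} (g : X ⟶ W) :
    ∃ (X' : E) (q : X' ⟶ X), Deflation q ∧ Eff t (q ≫ g) := by
  cases t with
  | base i p hc =>
    obtain ⟨F, i'', p'', q, hc'', hi'', hpb⟩ := hc.pull g
    exact ⟨F, p'', hc''.defl, q, hpb.w⟩
  | step i p hc t =>
    obtain ⟨F, i'', p'', q, hc'', hi'', hpb⟩ := hc.pull g
    refine ⟨F, p'', hc''.defl, ?_⟩
    rw [← hpb.w]
    exact Eff.step_of_lift _

/-- A trivialisation of a pulled back `step` can be realised by refining any conflation over it. -/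
lemma Eff.step_refine {Y : E} {n : ℕ} {K A W : E} {i : K ⟶ A} {p : A ⟶ W} {hc : Conf i p}
    {t : Tw Y n K} {X : E} {g : X ⟶ W} (hg : Eff (Tw.step i p hc t) g)
    {K0 E0 : E} {i0 : K0 ⟶ E0} {p0 : E0 ⟶ X} (hc0 : Conf i0 p0) {e0 : E0 ⟶ A} {k0 : K0 ⟶ K}
    (h1 : e0 ≫ p = p0 ≫ g) (h2 : i0 ≫ e0 = k0 ≫ i) :
    ∃ (K1 E1 : E) (i1 : K1 ⟶ E1) (q : E1 ⟶ E0) (κ : K1 ⟶ K0), Deflation q ∧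
      Conf i1 (q ≫ p0) ∧ i1 ≫ q = κ ≫ i0 ∧ Eff t (κ ≫ k0) := by
  obtain ⟨K', E', i', p', e, k, hc', h1', h2', h3'⟩ := hg
  obtain ⟨KF, F, j, a, b, κ1, κ2, hcF, hb, hab, hκ1, hκ2⟩ := hc'.fiber hc0
  obtain ⟨δ, hδ⟩ := hc.lift (b ≫ e0 - a ≫ e) (by
    simp only [Preadditive.sub_comp, Category.assoc, h1, h2']
    rw [← Category.assoc a, hab, Category.assoc, sub_self])
  obtain ⟨E2, r, hr, hE2⟩ := t.efface δ
  obtain ⟨K2, i2, κ, hc2, hκ⟩ := hcF.refine hr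
  have hm := hc.mono
  refine ⟨K2, E2, i2, r ≫ b, κ ≫ κ2, IsExactCat.comp_deflation _ _ hr hb, ?_, ?_, ?_⟩
  · rw [Category.assoc]; exact hc2
  · rw [← Category.assoc, hκ, Category.assoc, hκ2, Category.assoc]
  · have : (κ ≫ κ2) ≫ k0 = i2 ≫ r ≫ δ + (κ ≫ κ1) ≫ k := by
      rw [← cancel_mono i]
      simp only [Preadditive.add_comp, Category.assoc, hδ, ← h2, ← h1']
      simp only [Preadditive.comp_sub]
      have e1 : i2 ≫ r ≫ b ≫ e0 = κ ≫ κ2 ≫ i0 ≫ e0 := by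
        rw [← Category.assoc i2, hκ, Category.assoc, ← Category.assoc j, hκ2, Category.assoc]
      have e2 : i2 ≫ r ≫ a ≫ e = κ ≫ κ1 ≫ i' ≫ e := by
        rw [← Category.assoc i2, hκ, Category.assoc, ← Category.assoc j, hκ1, Category.assoc]
      rw [e1, e2]; simp
    rw [this]
    exact (hE2.precomp _ _).add _ (h3'.precomp _ _)

lemma TMor.eff {Y Y' : E} {b : Y ⟶ Y'} {n : ℕ} {W W' : E} {s : Tw Y n W} {t : Tw Y' n W'}
    {a : W ⟶ W'} (m : TMor b s t a) : ∀ {X : E} {g : X ⟶ W}, Eff s g → Eff t (g ≫ a) := by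
  induction m with
  | base i p h i' p' h' a e h1 h2 =>
    rintro X g ⟨l, hl⟩
    exact ⟨l ≫ e, by rw [Category.assoc, h2, ← Category.assoc, hl]⟩
  | step i p h i' p' h' a e k t t' h1 h2 hk ih =>
    rintro X g ⟨K1, E1, i1, p1, e1, k1, hc1, h3, h4, h5⟩
    refine ⟨K1, E1, i1, p1, e1 ≫ e, k1 ≫ k, hc1, ?_, ?_, ih h5⟩
    · rw [← Category.assoc, h3, Category.assoc, h1, Category.assoc]
    · rw [Category.assoc, h2, ← Category.assoc, h4, Category.assoc]

lemma TMor.eff_symm {Y Y' : E} {b : Y ⟶ Y'} [IsIso b] {n : ℕ} {W W' : E} {s : Tw Y n W}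
    {t : Tw Y' n W'} {a : W ⟶ W'} (m : TMor b s t a) :
    ∀ {X : E} {g : X ⟶ W}, Eff t (g ≫ a) → Eff s g := by
  induction m with
  | base i p h i' p' h' a e h1 h2 =>
    rintro X g ⟨l, hl⟩
    obtain ⟨F, i'', p'', q, hc'', hi'', hpb⟩ := h.pull g
    obtain ⟨δ, hδ⟩ := h'.lift (q ≫ e - p'' ≫ l) (by
      simp only [Preadditive.sub_comp, Category.assoc, h2, hl]
      rw [← Category.assoc q, hpb.w, Category.assoc, sub_self])
    have hm := h'.mono
    have hep := hc''.epi
    obtain ⟨r, hr⟩ := hc''.desc (q - δ ≫ inv b ≫ i) (by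
      have : i'' ≫ δ = b := by
        rw [← cancel_mono i', Category.assoc, hδ, Preadditive.comp_sub, ← Category.assoc, hi'', h1,
          ← Category.assoc, hc''.w]
        simp
      rw [Preadditive.comp_sub, hi'', ← Category.assoc, this]; simp)
    refine ⟨r, ?_⟩
    rw [← cancel_epi p'', ← Category.assoc, hr]
    simp [h.w, hpb.w]
  | step i p h i' p' h' a e k t t' h1 h2 hk ih =>
    intro X g hg
    obtain ⟨F, i0, p0, q, hc0, hi0, hpb⟩ := h.pull g
    obtain ⟨K1, E1, i1, r, κ, hr, hc1, hκ, hE⟩ := hg.step_refine hc0 (e0 := q ≫ e) (k0 := k)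
      (by rw [Category.assoc, h2, ← Category.assoc, hpb.w, Category.assoc])
      (by rw [← Category.assoc, hi0, h1])
    refine ⟨K1, E1, i1, r ≫ p0, r ≫ q, κ, hc1, ?_, ?_, ih hE⟩
    · rw [← Category.assoc, hκ, Category.assoc, hi0]
    · rw [Category.assoc, hpb.w, Category.assoc]

/-- Pullback of towers. -/
lemma Tw.exists_pull {Y : E} {n : ℕ} {W : E} (t : Tw Y n W) {X : E} (g : X ⟶ W) :
    ∃ t' : Tw Y n X, TMor (𝟙 Y) t' t g := by
  have refl : ∀ {n : ℕ} {W : E} (t : Tw Y n W), TMor (𝟙 Y) t t (𝟙 W) := by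
    intro n W t
    induction t with
    | base i p hc => exact TMor.base _ _ _ _ _ _ _ (𝟙 _) (by simp) (by simp)
    | step i p hc t ih => exact TMor.step _ _ _ _ _ _ _ (𝟙 _) (𝟙 _) _ _ (by simp) (by simp) ih
  cases t with
  | base i p hc =>
    obtain ⟨F, i0, p0, q, hc0, hi0, hpb⟩ := hc.pull g
    exact ⟨.base i0 p0 hc0, TMor.base _ _ _ _ _ _ _ q (by simp [hi0]) hpb.w⟩
  | step i p hc t =>
    obtain ⟨F, i0, p0, q, hc0, hi0, hpb⟩ := hc.pull g
    exact ⟨.step i0 p0 hc0 t, TMor.step _ _ _ _ _ _ _ q (𝟙 _) _ _ (by simp [hi0]) hpb.w (refl t)⟩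

lemma V.of_id {n : ℕ} {X Y : E} (h : ∀ t : Tw Y n X, Eff t (𝟙 X)) : V n X Y := by
  intro W t g
  obtain ⟨t', m⟩ := t.exists_pull g
  simpa using m.eff (h t')

lemma V.of_retract {n : ℕ} {X X' Y : E} (h : V n X Y) (i : X' ⟶ X) (r : X ⟶ X')
    (hir : i ≫ r = 𝟙 X') : V n X' Y := by
  intro W t g
  have := (h W t (r ≫ g)).precomp _ i
  rwa [← Category.assoc, hir, Category.id_comp] at this

lemma V.of_iso {n : ℕ} {X X' Y : E} (h : V n X Y) (e : X ≅ X') : V n X' Y :=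
  h.of_retract e.inv e.hom (by simp)

lemma V.biprod [HasBinaryBiproducts E] {n : ℕ} {X X' Y : E} (h : V n X Y) (h' : V n X' Y) :
    V n (X ⊞ X') Y := by
  intro W t g
  have e : g = biprod.fst ≫ biprod.inl ≫ g + biprod.snd ≫ biprod.inr ≫ g := by
    apply biprod.hom_ext' <;> simp
  rw [e]
  exact ((h W t _).precomp _ _).add _ ((h' W t _).precomp _ _)

lemma EProj.V {P : E} (hP : EProj E P) (n : ℕ) (Y : E) : V n P Y := by
  intro W t g
  cases t with
  | base i p hc => exact hP p hc.defl g
  | step i p hc t =>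
    obtain ⟨l, hl⟩ := hP p hc.defl g
    rw [← hl]
    exact Eff.step_of_lift l

/-- Dimension shift. -/
lemma V.succ_of_proj {n : ℕ} {K Q X Y : E} {i : K ⟶ Q} {p : Q ⟶ X} (hc : Conf i p)
    (hQ : EProj E Q) (h : V n K Y) : V (n + 1) X Y := by
  intro W t g
  cases t with
  | step j q hc' t =>
    obtain ⟨l, hl⟩ := hQ q hc'.defl (p ≫ g)
    obtain ⟨k, hk⟩ := hc.induced hc' hl
    exact ⟨K, Q, i, p, l, k, hc, hk, hl, h _ _ _⟩

lemma V.of_succ_of_proj {n : ℕ} {K Q X Y : E} {i : K ⟶ Q} {p : Q ⟶ X} (hc : Conf i p)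
    (hQ : EProj E Q) (h : V (n + 1) X Y) : V n K Y := by
  refine V.of_id ?_
  intro t
  obtain ⟨K1, E1, i1, q, κ, hq, hc1, hκ, hE⟩ :=
    (h _ (.step i p hc t) (𝟙 X)).step_refine hc (e0 := 𝟙 _) (k0 := 𝟙 _) (by simp) (by simp)
  obtain ⟨s, hs⟩ := hQ q hq (𝟙 Q)
  obtain ⟨k, hk⟩ := hc.induced hc1 (g := 𝟙 X) (e := s) (by rw [← Category.assoc, hs]; simp)
  have := hE.precomp _ k
  have e : k ≫ κ ≫ 𝟙 K = 𝟙 K := by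
    have := hc.mono
    rw [← cancel_mono i]
    simp only [Category.comp_id, Category.assoc, ← hκ]
    rw [← Category.assoc, ← hk, Category.assoc, hs]; simp
  rwa [e] at this

/-- `V 0` of the quotient from extension property. -/
lemma V.zero_of_ext {K Q X Y : E} {i : K ⟶ Q} {p : Q ⟶ X} (hc : Conf i p)
    (hQ : V 0 Q Y) (h : ∀ f : K ⟶ Y, ∃ f' : Q ⟶ Y, i ≫ f' = f) : V 0 X Y := by
  intro W t g
  cases t with
  | base j q hc' =>
    obtain ⟨l, hl⟩ := hQ W (.base j q hc') (p ≫ g)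
    obtain ⟨k, hk⟩ := hc.induced hc' hl
    obtain ⟨f', hf'⟩ := h k
    obtain ⟨r, hr⟩ := hc.desc (l - f' ≫ j) (by
      rw [Preadditive.comp_sub, hk, ← Category.assoc, hf', sub_self])
    have := hc.epi
    refine ⟨r, ?_⟩
    rw [← cancel_epi p, ← Category.assoc, hr]
    simp [hc'.w, hl]

lemma V.ext_of_zero {K Q X Y : E} {i : K ⟶ Q} {p : Q ⟶ X} (hc : Conf i p)
    (h : V 0 X Y) (f : K ⟶ Y) : ∃ f' : Q ⟶ Y, i ≫ f' = f := by
  obtain ⟨W, i', p', q, hc', hq, hpo⟩ := hc.push f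
  obtain ⟨l, hl⟩ := h X (.base i' p' hc') (𝟙 X)
  obtain ⟨r, hr⟩ := hc'.lift (𝟙 W - p' ≫ l) (by simp [hl])
  have := hc'.mono
  refine ⟨q ≫ r, ?_⟩
  rw [← Category.assoc, hpo.w, Category.assoc]
  have : i' ≫ r = 𝟙 Y := by
    rw [← cancel_mono i', Category.assoc, hr, Preadditive.comp_sub, ← Category.assoc, hc'.w]
    simp
  rw [this, Category.comp_id]

end Towers

section LongExact

variable [ExactCatStruct E] [IsExactCat E] [HasZeroObject E] [HasBinaryBiproducts E]

lemma cov_zero_aux {K N C : E} {φ : K ⟶ N} {ψ : N ⟶ C} (hφ : Conf φ ψ) {W : E} (t : Tw K 0 W) :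
    ∃ t' : Tw N 0 W, ∀ (X : E) (g : X ⟶ W), Eff t' g → ∃ u : X ⟶ C,
      ∀ (X' : E) (h : X' ⟶ X) (n : X' ⟶ N), n ≫ ψ = h ≫ u → Eff t (h ≫ g) := by
  cases t with
  | base i p hc =>
    obtain ⟨A', i', p', q, hc', hq, hpo⟩ := hc.push φ
    refine ⟨.base i' p' hc', ?_⟩
    rintro X g ⟨x, hx⟩
    let c := hpo.desc (0 : _ ⟶ C) ψ (by rw [hφ.w, comp_zero])
    have hc1 : q ≫ c = 0 := by simp [c]
    have hc2 : i' ≫ c = ψ := by simp [c]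
    refine ⟨x ≫ c, ?_⟩
    intro X' h n hn
    obtain ⟨F, i0, p0, q0, hc0, hi0, hpb⟩ := hc.pull (h ≫ g)
    have hy : (h ≫ x - n ≫ i') ≫ p' = h ≫ g := by simp [hx, hc'.w]
    obtain ⟨δ, hδ⟩ := hc'.lift (q0 ≫ q - p0 ≫ (h ≫ x - n ≫ i')) (by
      rw [Preadditive.sub_comp, Category.assoc, Category.assoc, hy, hq, hpb.w, sub_self])
    have hδψ : δ ≫ ψ = 0 := by
      rw [← hc2, ← Category.assoc, hδ]
      simp [hc1, hc2, hn]
    obtain ⟨ρ, hρ⟩ := hφ.lift δ hδψ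
    have m1 := hc'.mono
    have m2 := hφ.mono
    have e1 : i0 ≫ δ = φ := by
      rw [← cancel_mono i', Category.assoc, hδ, Preadditive.comp_sub, ← Category.assoc, hi0,
        hpo.w, ← Category.assoc i0, hc0.w]
      simp
    have e2 : i0 ≫ ρ = 𝟙 K := by
      rw [← cancel_mono φ, Category.assoc, hρ, e1, Category.id_comp]
    obtain ⟨r, hr⟩ := hc0.desc (q0 - ρ ≫ i) (by
      rw [Preadditive.comp_sub, hi0, ← Category.assoc, e2]; simp)
    have := hc0.epi
    refine ⟨r, ?_⟩
    rw [← cancel_epi p0, ← Category.assoc, hr]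
    simp [hc.w, hpb.w]

lemma cov_succ_aux {K N C : E} {φ : K ⟶ N} {ψ : N ⟶ C} (hφ : Conf φ ψ) (n : ℕ) :
    ∀ {W : E} (t : Tw K (n + 1) W),
    ∃ t' : Tw N (n + 1) W, ∀ (X : E) (g : X ⟶ W), Eff t' g → ∃ u : Tw C n X,
      ∀ (X' : E) (h : X' ⟶ X), Eff u h → Eff t (h ≫ g) := by
  induction n with
  | zero =>
    intro W t
    cases t with
    | step i p hc t0 =>
      obtain ⟨t0', ht0'⟩ := cov_zero_aux hφ t0
      refine ⟨.step i p hc t0', ?_⟩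
      rintro X g ⟨K', E', i', p', e, k, hc', h1, h2, h3⟩
      obtain ⟨u0, hu0⟩ := ht0' _ _ h3
      obtain ⟨D, j, r, q, hcD, hq, hpo⟩ := hc'.push u0
      refine ⟨.base j r hcD, ?_⟩
      rintro X' h ⟨l, hl⟩
      obtain ⟨F, i1, p1, q1, hc1, hi1, hpb⟩ := hc'.pull h
      obtain ⟨δ, hδ⟩ := hcD.lift (q1 ≫ q - p1 ≫ l) (by
        rw [Preadditive.sub_comp, Category.assoc, Category.assoc, hl, hq, hpb.w, sub_self])
      have m1 := hcD.mono
      have e1 : i1 ≫ δ = u0 := by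
        rw [← cancel_mono j, Category.assoc, hδ, Preadditive.comp_sub, ← Category.assoc, hi1,
          hpo.w, ← Category.assoc i1, hc1.w]
        simp
      obtain ⟨F2, _, r2, m, hcF2, _, hpb2⟩ := hφ.pull δ
      obtain ⟨K2, i2, κ, hc2, hκ⟩ := hc1.refine hcF2.defl
      refine ⟨K2, F2, i2, r2 ≫ p1, r2 ≫ q1 ≫ e, κ ≫ k, hc2, ?_, ?_, ?_⟩
      · rw [← Category.assoc, hκ, Category.assoc, ← Category.assoc i1, hi1, h1, Category.assoc]
      · rw [Category.assoc, Category.assoc, h2, ← Category.assoc q1, hpb.w]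
        simp only [Category.assoc]
      · refine hu0 _ κ (i2 ≫ m) ?_
        rw [Category.assoc, hpb2.w, ← Category.assoc, hκ, Category.assoc, e1]
  | succ n ih =>
    intro W t
    cases t with
    | step i p hc t0 =>
      obtain ⟨t0', ht0'⟩ := ih t0
      refine ⟨.step i p hc t0', ?_⟩
      rintro X g ⟨K', E', i', p', e, k, hc', h1, h2, h3⟩
      obtain ⟨u0, hu0⟩ := ht0' _ _ h3
      refine ⟨.step i' p' hc' u0, ?_⟩
      rintro X' h ⟨K2, E2, i2, p2, e2, k2, hc2, h4, h5, h6⟩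
      refine ⟨K2, E2, i2, p2, e2 ≫ e, k2 ≫ k, hc2, ?_, ?_, hu0 _ _ h6⟩
      · rw [← Category.assoc, h4, Category.assoc, h1, Category.assoc]
      · rw [Category.assoc, h2, ← Category.assoc, h5, Category.assoc]

lemma V.cov_zero {K N C X : E} {φ : K ⟶ N} {ψ : N ⟶ C} (hφ : Conf φ ψ) (hN : V 0 X N)
    (hC : ∀ f : X ⟶ C, ∃ f' : X ⟶ N, f' ≫ ψ = f) : V 0 X K := by
  intro W t g
  obtain ⟨t', ht'⟩ := cov_zero_aux hφ t
  obtain ⟨u, hu⟩ := ht' X g (hN _ _ _)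
  obtain ⟨n, hn⟩ := hC u
  simpa using hu X (𝟙 X) n (by simpa using hn)

lemma V.cov_succ {K N C X : E} {φ : K ⟶ N} {ψ : N ⟶ C} (hφ : Conf φ ψ) {n : ℕ}
    (hN : V (n + 1) X N) (hC : V n X C) : V (n + 1) X K := by
  intro W t g
  obtain ⟨t', ht'⟩ := cov_succ_aux hφ n t
  obtain ⟨u, hu⟩ := ht' X g (hN _ _ _)
  simpa using hu X (𝟙 X) (hC _ _ _)

/-- Rotation of a conflation using a projective cover. -/
lemma Conf.rot {A B C L Q : E} {i : A ⟶ B} {p : B ⟶ C} (h : Conf i p) {j : L ⟶ Q} {q : Q ⟶ C}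
    (hq : Conf j q) (hQ : EProj E Q) : ∃ (m : L ⟶ A ⊞ Q) (r : A ⊞ Q ⟶ B), Conf m r ∧
      m ≫ biprod.snd = j := by
  obtain ⟨F, j', q', f, hc, hj', hpb⟩ := hq.pull p
  obtain ⟨s, hs⟩ := hQ p h.defl q
  obtain ⟨ρ, hρ⟩ := h.lift (q' - f ≫ s) (by
    rw [Preadditive.sub_comp, Category.assoc, hs, hpb.w, sub_self])
  have hm := h.mono
  let e1 : A ⊞ Q ⟶ F := hpb.lift biprod.snd (biprod.desc i s) (by
    apply biprod.hom_ext' <;> simp [h.w, hs])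
  let e2 : F ⟶ A ⊞ Q := biprod.lift ρ f
  have e1f : e1 ≫ f = biprod.snd := by simp [e1]
  have e1q : e1 ≫ q' = biprod.desc i s := by simp [e1]
  have h12 : e1 ≫ e2 = 𝟙 _ := by
    apply biprod.hom_ext
    · rw [← cancel_mono i]
      simp only [e2, Category.assoc, biprod.lift_fst, hρ, Preadditive.comp_sub, e1q,
        Category.id_comp]
      rw [← Category.assoc, e1f, biprod.desc_eq]; simp
    · simp [e2, e1f]
  have h21 : e2 ≫ e1 = 𝟙 _ := by
    apply hpb.hom_ext
    · rw [Category.assoc, e1f]; simp [e2]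
    · rw [Category.assoc, e1q]; simp [e2, hρ]
  refine ⟨j' ≫ e2, e1 ≫ q', hc.precomp_iso ⟨e1, e2, h12, h21⟩, ?_⟩
  simp [e2, hj']

/-- Enough projectives. -/
def EnoughP (E : Type u) [Category.{v} E] [Preadditive E] [ExactCatStruct E] : Prop :=
  ∀ X : E, ∃ P : E, EProj E P ∧ ∃ p : P ⟶ X, Deflation p

lemma EnoughP.conf (hP : EnoughP E) (X : E) :
    ∃ (L Q : E) (j : L ⟶ Q) (q : Q ⟶ X), EProj E Q ∧ Conf j q := by
  obtain ⟨Q, hQ, q, hq⟩ := hP X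
  obtain ⟨L, j, hc⟩ := hq.conf
  exact ⟨L, Q, j, q, hQ, hc⟩

lemma V.mid_imp (hP : EnoughP E) {Y : E} {n : ℕ}
    (S : ∀ {A B C : E} {i : A ⟶ B} {p : B ⟶ C}, Conf i p → V n A Y → V n C Y → V n B Y)
    {A B C : E} {i : A ⟶ B} {p : B ⟶ C} (h : Conf i p) (hA : V n A Y) (hB : V (n + 1) B Y) :
    V (n + 1) C Y := by
  have b : ∀ {A B C : E} {i : A ⟶ B} {p : B ⟶ C}, Conf i p → V (n + 1) C Y → V n B Y →
      V n A Y := by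
    intro A B C i p h hC hB
    obtain ⟨L, Q, j, q, hQ, hc⟩ := hP.conf C
    obtain ⟨m, r, hmr, _⟩ := h.rot hc hQ
    exact (S hmr (hC.of_succ_of_proj hc hQ) hB).of_retract biprod.inl biprod.fst (by simp)
  obtain ⟨L, Q, j, q, hQ, hc⟩ := hP.conf C
  obtain ⟨m, r, hmr, _⟩ := h.rot hc hQ
  exact (b hmr hB (hA.biprod (hQ.V _ _))).succ_of_proj hc hQ

lemma V.mid (hP : EnoughP E) {Y : E} (n : ℕ) :
    ∀ {A B C : E} {i : A ⟶ B} {p : B ⟶ C}, Conf i p → V n A Y → V n C Y → V n B Y := by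
  induction n with
  | zero =>
    intro A B C i p h hA hC
    obtain ⟨L, Q, j, q, hQ, hc⟩ := hP.conf C
    obtain ⟨m, r, hmr, hm⟩ := h.rot hc hQ
    refine V.zero_of_ext hmr (hA.biprod (hQ.V _ _)) ?_
    intro f
    obtain ⟨f', hf'⟩ := hC.ext_of_zero hc f
    exact ⟨biprod.snd ≫ f', by rw [← Category.assoc, hm, hf']⟩
  | succ n ih =>
    intro A B C i p h hA hC
    obtain ⟨L, Q, j, q, hQ, hc⟩ := hP.conf C
    obtain ⟨m, r, hmr, hm⟩ := h.rot hc hQ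
    exact V.mid_imp hP ih hmr (hC.of_succ_of_proj hc hQ) (hA.biprod (hQ.V _ _))

lemma V.third (hP : EnoughP E) {Y : E} {n : ℕ}
    {A B C : E} {i : A ⟶ B} {p : B ⟶ C} (h : Conf i p) (hA : V n A Y) (hB : V (n + 1) B Y) :
    V (n + 1) C Y :=
  V.mid_imp hP (V.mid hP n) h hA hB

lemma V.inj_shift (hP : EnoughP E) {K I C : E} {i : K ⟶ I} {p : I ⟶ C} (h : Conf i p)
    (hI : EInj E I) (n : ℕ) : ∀ {X : E}, V (n + 1) X K → V n X C := by
  induction n with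
  | zero =>
    intro X hX
    obtain ⟨L, Q, j, q, hQ, hc⟩ := hP.conf X
    have hL := hX.of_succ_of_proj hc hQ
    refine V.zero_of_ext hc (hQ.V _ _) ?_
    intro f
    obtain ⟨l, hl⟩ := hL C (.base i p h) f
    obtain ⟨l', hl'⟩ := hI j hc.infl l
    exact ⟨l' ≫ p, by rw [← Category.assoc, hl', hl]⟩
  | succ n ih =>
    intro X hX
    obtain ⟨L, Q, j, q, hQ, hc⟩ := hP.conf X
    exact (ih (hX.of_succ_of_proj hc hQ)).succ_of_proj hc hQ

end LongExact

section Sequences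

open ZeroObject

variable [ExactCatStruct E]

/-- Prepend an object to a sequence of objects. -/
def consSt (A : E) (O : ℕ → E) : ℕ → E
  | 0 => A
  | i + 1 => O i

lemma EExtSeq.conf {n : ℕ} {X Y : E} (s : EExtSeq E n X Y) (i : ℕ) : Conf (s.ι (i + 1)) (s.π i) :=
  ⟨s.w i, s.confl i⟩

variable [IsExactCat E] [HasZeroObject E]

/-- The trivial sequence `0 → Y → Y → 0`. -/
noncomputable def EExtSeq.nil (Y : E) : EExtSeq E 0 Y Y :=
  have hc : ∀ i : ℕ, Conf (0 : (0 : E) ⟶ consSt Y (fun _ => (0 : E)) i)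
      (match i with
        | 0 => 𝟙 Y
        | _ + 1 => 0 : consSt Y (fun _ => (0 : E)) i ⟶ consSt Y (fun _ => 0) i) := by
    intro i
    match i with
    | 0 => exact conf_zero_id (isZero_zero E) Y
    | i + 1 =>
      have h := conf_zero_id (isZero_zero E) (0 : E)
      rwa [(isZero_zero E).eq_of_src (𝟙 (0 : E)) 0] at h
  { ob := consSt Y (consSt Y (fun _ => 0))
    Z := consSt Y (fun _ => 0)
    π := fun i => match i with
      | 0 => 𝟙 Y
      | _ + 1 => 0
    ι := fun i => match i with
      | 0 => 𝟙 Y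
      | _ + 1 => 0
    iso0 := Iso.refl Y
    isoTop := Iso.refl Y
    ob_zero := fun i hi => by
      match i, hi with
      | i + 2, _ => exact isZero_zero E
    Z_zero := fun i hi => by
      match i, hi with
      | i + 1, _ => exact isZero_zero E
    w := fun i => (hc i).w
    confl := fun i => (hc i).2
    iso_bot := inferInstanceAs (IsIso (𝟙 Y)) }

/-- Splice a conflation with an exact sequence. -/
def EExtSeq.cons {n : ℕ} {K A X Y : E} {i : K ⟶ A} {p : A ⟶ X} (hc : Conf i p)
    (s : EExtSeq E n K Y) : EExtSeq E (n + 1) X Y :=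
  have h0 : Conf (s.ι 0 ≫ s.iso0.hom ≫ i) p := by
    have := s.iso_bot
    have := hc.left_iso (asIso (s.ι 0) ≪≫ s.iso0)
    simpa using this
  { ob := consSt X (consSt A (fun i => s.ob (i + 1)))
    Z := consSt X s.Z
    π := fun k => match k with
      | 0 => p
      | k + 1 => s.π k
    ι := fun k => match k with
      | 0 => 𝟙 X
      | 1 => s.ι 0 ≫ s.iso0.hom ≫ i
      | k + 2 => s.ι (k + 1)
    iso0 := Iso.refl X
    isoTop := s.isoTop
    ob_zero := fun i hi => by
      match i, hi with
      | i + 2, hi => exact s.ob_zero (i + 1) (by omega)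
    Z_zero := fun i hi => by
      match i, hi with
      | i + 1, hi => exact s.Z_zero i (by omega)
    w := fun i => match i with
      | 0 => h0.w
      | i + 1 => s.w i
    confl := fun i => match i with
      | 0 => h0.2
      | i + 1 => s.confl i
    iso_bot := inferInstanceAs (IsIso (𝟙 X)) }

/-- Streams of conflations underlying an exact sequence. -/
structure St (Y : E) (m : ℕ) where
  O : ℕ → E
  Z : ℕ → E
  π : ∀ i, O i ⟶ Z i
  j : ∀ i, Z (i + 1) ⟶ O i
  c : ∀ i, Conf (j i) (π i)
  y : Y ⟶ O (m + 1)
  h : Conf (y ≫ π (m + 1) ≫ j m) (π m)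

/-- The tail of a stream. -/
def St.tail {Y : E} {m : ℕ} (S : St Y (m + 1)) : St Y m where
  O i := S.O (i + 1)
  Z i := S.Z (i + 1)
  π i := S.π (i + 1)
  j i := S.j (i + 1)
  c i := S.c (i + 1)
  y := S.y
  h := S.h

/-- The tower of a stream. -/
def St.tw {Y : E} : ∀ {m : ℕ} (S : St Y m), Tw Y m (S.Z 0)
  | 0, S => .base (S.y ≫ S.π 1 ≫ S.j 0) (S.π 0) S.h
  | _ + 1, S => .step (S.j 0) (S.π 0) (S.c 0) S.tail.tw

lemma EExtSeq.isIso_pi_top {n : ℕ} {X Y : E} (s : EExtSeq E n X Y) : IsIso (s.π n) :=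
  (s.conf n).isIso_of_zero (s.Z_zero _ (by omega))

/-- The stream of an exact sequence. -/
def EExtSeq.st {m : ℕ} {X Y : E} (s : EExtSeq E (m + 1) X Y) : St Y m where
  O i := s.ob (i + 1)
  Z i := s.Z i
  π i := s.π i
  j i := s.ι (i + 1)
  c i := s.conf i
  y := s.isoTop.inv
  h := by
    have := s.isIso_pi_top
    have := (s.conf m).left_iso (s.isoTop.symm ≪≫ asIso (s.π (m + 1)))
    simpa using this

/-- Identification of the base of the tower. -/
noncomputable def EExtSeq.x {n : ℕ} {X Y : E} (s : EExtSeq E n X Y) : X ⟶ s.Z 0 :=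
  have := s.iso_bot
  s.iso0.inv ≫ inv (s.ι 0)

lemma EExtSeq.x_comp {n : ℕ} {X Y : E} (s : EExtSeq E n X Y) : s.x ≫ s.ι 0 = s.iso0.inv := by
  have := s.iso_bot
  simp [EExtSeq.x]

lemma St.tmor {Y : E} : ∀ {m : ℕ} (S S' : St Y m) (φ : ∀ i, S.O i ⟶ S'.O i)
    (ζ : ∀ i, S.Z i ⟶ S'.Z i) (_ : ∀ i, φ i ≫ S'.π i = S.π i ≫ ζ i)
    (_ : ∀ i, S.j i ≫ φ i = ζ (i + 1) ≫ S'.j i) (_ : S.y ≫ φ (m + 1) = S'.y),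
    TMor (𝟙 Y) S.tw S'.tw (ζ 0)
  | 0, S, S', φ, ζ, h1, h2, h3 => by
    refine TMor.base _ _ _ _ _ _ _ (φ 0) ?_ (h1 0)
    rw [Category.assoc, Category.assoc, h2 0, Category.id_comp, ← h3, Category.assoc]
    congr 1
    rw [← Category.assoc, ← Category.assoc]
    congr 1
    exact (h1 1).symm
  | m + 1, S, S', φ, ζ, h1, h2, h3 => by
    exact TMor.step _ _ _ _ _ _ _ (φ 0) (ζ 1) _ _ (h2 0) (h1 0)
      (St.tmor S.tail S'.tail (fun i => φ (i + 1)) (fun i => ζ (i + 1)) (fun i => h1 (i + 1))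
        (fun i => h2 (i + 1)) h3)

lemma EExtSeq.mono_ι {n : ℕ} {X Y : E} (s : EExtSeq E n X Y) (i : ℕ) : Mono (s.ι i) := by
  match i with
  | 0 => have := s.iso_bot; infer_instance
  | i + 1 => exact (s.conf i).mono

lemma Eff.congr {Y : E} {n : ℕ} {W : E} (t : Tw Y n W) {X : E} {g g' : X ⟶ W} (h : Eff t g)
    (e : g = g') : Eff t g' := e ▸ h

lemma EExtSeqHom.triv_iff {m : ℕ} {X Y : E} {s t : EExtSeq E (m + 1) X Y} (f : EExtSeqHom s t) :
    Eff s.st.tw s.x ↔ Eff t.st.tw t.x := by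
  have hz : ∀ i, ∃ z : s.Z i ⟶ t.Z i, s.π i ≫ z = f.φ (i + 1) ≫ t.π i := by
    intro i
    refine (s.conf i).desc _ ?_
    have := t.mono_ι i
    have hep := (s.conf (i + 1)).epi
    rw [← cancel_mono (t.ι i), ← cancel_epi (s.π (i + 1))]
    have h1 := f.comm (i + 1)
    have h2 := f.comm i
    have h3 := s.dd_comp i
    unfold EExtSeq.dd at h1 h2 h3
    simp only [zero_comp, comp_zero, Category.assoc] at *
    rw [← h2]
    have : (s.π (i + 1) ≫ s.ι (i + 1) ≫ s.π i ≫ s.ι i) ≫ f.φ i = 0 := by rw [h3, zero_comp]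
    simpa using this
  choose ζ hζ using hz
  have hj : ∀ i, s.ι i ≫ f.φ i = ζ i ≫ t.ι i := by
    intro i
    have hep := (s.conf i).epi
    rw [← cancel_epi (s.π i), ← Category.assoc (s.π i) (ζ i), hζ, ← Category.assoc]
    have h1 := f.comm i
    unfold EExtSeq.dd at h1
    rw [h1, Category.assoc]
  have hm : TMor (𝟙 Y) s.st.tw t.st.tw (ζ 0) :=
    St.tmor s.st t.st (fun i => f.φ (i + 1)) ζ (fun i => (hζ i).symm) (fun i => hj (i + 1))
      (by change s.isoTop.inv ≫ f.φ (m + 1 + 1) = t.isoTop.inv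
          rw [f.φTop]; simp)
  have hx : s.x ≫ ζ 0 = t.x := by
    have := t.mono_ι 0
    rw [← cancel_mono (t.ι 0), Category.assoc, ← hj, ← Category.assoc, s.x_comp, t.x_comp, f.φ0]
    simp
  constructor
  · intro h
    exact Eff.congr _ (hm.eff h) hx
  · intro h
    exact hm.eff_symm (Eff.congr _ h hx.symm)

lemma EYonedaEquiv.triv_iff {m : ℕ} {X Y : E} {s t : EExtSeq E (m + 1) X Y}
    (h : EYonedaEquiv s t) : Eff s.st.tw s.x ↔ Eff t.st.tw t.x := by
  induction h with
  | rel _ _ h => obtain ⟨f⟩ := h; exact f.triv_iff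
  | refl _ => exact Iff.rfl
  | symm _ _ _ ih => exact ih.symm
  | trans _ _ _ _ _ ih1 ih2 => exact ih1.trans ih2

lemma Tw.exists_seq {Y : E} {n : ℕ} {X : E} (t : Tw Y n X) :
    ∃ s : EExtSeq E (n + 1) X Y, TMor (𝟙 Y) t s.st.tw s.x := by
  induction t with
  | @base A X i p hc =>
    refine ⟨EExtSeq.cons hc (EExtSeq.nil Y), TMor.base _ _ _ _ _ _ _ (𝟙 A) ?_ ?_⟩
    · change i ≫ 𝟙 A = 𝟙 Y ≫ 𝟙 Y ≫ 𝟙 Y ≫ 𝟙 Y ≫ 𝟙 Y ≫ i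
      simp
    · change 𝟙 A ≫ p = p ≫ 𝟙 X ≫ inv (𝟙 X)
      simp
  | @step n K A X i p hc t ih =>
    obtain ⟨s, hs⟩ := ih
    refine ⟨EExtSeq.cons hc s, TMor.step _ _ _ _ _ _ _ (𝟙 A) s.x _ _ ?_ ?_ hs⟩
    · change i ≫ 𝟙 A = s.x ≫ s.ι 0 ≫ s.iso0.hom ≫ i
      rw [← Category.assoc, s.x_comp]
      simp
    · change 𝟙 A ≫ p = p ≫ 𝟙 X ≫ inv (𝟙 X)
      simp

/-- A map from an exact sequence to a stream. -/
def SMap {m : ℕ} {X Y : E} (s0 : EExtSeq E (m + 1) X Y) (S : St Y m) (g : X ⟶ S.Z 0) : Prop :=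
  ∃ φ : ∀ i, s0.ob (i + 1) ⟶ S.O i, φ 0 ≫ S.π 0 = s0.dd 0 ≫ s0.iso0.hom ≫ g ∧
    (∀ i, s0.dd (i + 1) ≫ φ i = φ (i + 1) ≫ S.π (i + 1) ≫ S.j i) ∧
    φ (m + 1) = s0.isoTop.hom ≫ S.y

lemma SMap.hom {m : ℕ} {X Y : E} {s0 s : EExtSeq E (m + 1) X Y} (h : SMap s0 s.st s.x) :
    Nonempty (EExtSeqHom s0 s) := by
  obtain ⟨φ, h1, h2, h3⟩ := h
  refine ⟨⟨fun i => match i with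
    | 0 => s0.iso0.hom ≫ s.iso0.inv
    | i + 1 => φ i, ?_, rfl, h3⟩⟩
  intro i
  match i with
  | 0 =>
    have key : ∀ f : s0.ob 1 ⟶ s.ob 1, f ≫ s.π 0 = s0.dd 0 ≫ s0.iso0.hom ≫ s.x →
        s0.dd 0 ≫ s0.iso0.hom ≫ s.iso0.inv = f ≫ s.π 0 ≫ s.ι 0 := by
      intro f h
      rw [← Category.assoc f, h, ← s.x_comp]
      simp
    exact key (φ 0) h1
  | i + 1 => exact h2 i

lemma SMap.cons {m : ℕ} {K F X Y : E} {i : K ⟶ F} {p : F ⟶ X} (hc : Conf i p)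
    {s1 : EExtSeq E (m + 1) K Y} {S : St Y (m + 1)} {g : X ⟶ S.Z 0} {k : K ⟶ S.Z 1}
    (e : F ⟶ S.O 0) (h1 : i ≫ e = k ≫ S.j 0) (h2 : e ≫ S.π 0 = p ≫ g) (h : SMap s1 S.tail k) :
    SMap (EExtSeq.cons hc s1) S g := by
  obtain ⟨φ, h3, h4, h5⟩ := h
  refine ⟨fun i => match i with
    | 0 => e
    | i + 1 => φ i, ?_, ?_, h5⟩
  · change e ≫ S.π 0 = (p ≫ 𝟙 X) ≫ 𝟙 X ≫ g
    simp [h2]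
  · intro a
    match a with
    | 0 =>
      have key : ∀ f : s1.ob 1 ⟶ S.O 1, f ≫ S.π 1 = (s1.π 0 ≫ s1.ι 0) ≫ s1.iso0.hom ≫ k →
          (s1.π 0 ≫ s1.ι 0 ≫ s1.iso0.hom ≫ i) ≫ e = f ≫ S.π 1 ≫ S.j 0 := by
        intro f h
        rw [← Category.assoc f, h]
        simp [h1]
      exact key (φ 0) h3
    | a + 1 => exact h4 a

variable [HasBinaryBiproducts E]

lemma SMap.base {X Y : E} {S : St Y 0} {g : X ⟶ S.Z 0} (h : Eff S.tw g) :
    SMap (EExtSeq.cons (conf_biprod Y X) (EExtSeq.nil Y)) S g := by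
  obtain ⟨l, hl⟩ := h
  refine ⟨fun i => match i with
    | 0 => biprod.desc (S.y ≫ S.π 1 ≫ S.j 0) l
    | 1 => S.y
    | i + 2 => 0, ?_, ?_, ?_⟩
  · change biprod.desc (S.y ≫ S.π 1 ≫ S.j 0) l ≫ S.π 0 = (biprod.snd ≫ 𝟙 X) ≫ 𝟙 X ≫ g
    have := (S.c 0).w
    apply biprod.hom_ext' <;> simp [hl, this]
  · intro a
    match a with
    | 0 =>
      change (𝟙 Y ≫ 𝟙 Y ≫ 𝟙 Y ≫ biprod.inl) ≫ biprod.desc (S.y ≫ S.π 1 ≫ S.j 0) l =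
        S.y ≫ S.π 1 ≫ S.j 0
      simp
    | a + 1 => exact (isZero_zero E).eq_of_src _ _
  · change S.y = 𝟙 Y ≫ S.y
    simp

lemma exists_common {Y : E} : ∀ {m : ℕ} {X : E} {S S' : St Y m} {g : X ⟶ S.Z 0} {g' : X ⟶ S'.Z 0}
    (_ : Eff S.tw g) (_ : Eff S'.tw g'),
    ∃ s0 : EExtSeq E (m + 1) X Y, SMap s0 S g ∧ SMap s0 S' g'
  | 0, X, S, S', g, g', h, h' => ⟨_, SMap.base h, SMap.base h'⟩
  | m + 1, X, S, S', g, g', h, h' => by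
    obtain ⟨K1, E1, i1, p1, e1, k1, hc1, h1, h2, h3⟩ := h
    obtain ⟨K1', E1', i1', p1', e1', k1', hc1', h1', h2', h3'⟩ := h'
    obtain ⟨K, F, i, a, b, κ1, κ2, hc, hb, hab, ha, hb'⟩ := hc1.fiber hc1'
    obtain ⟨s1, hs1, hs1'⟩ := exists_common (h3.precomp _ κ1) (h3'.precomp _ κ2)
    refine ⟨EExtSeq.cons hc s1, SMap.cons hc (a ≫ e1) ?_ ?_ hs1, SMap.cons hc (b ≫ e1') ?_ ?_ hs1'⟩
    · rw [← Category.assoc, ha, Category.assoc, h1, Category.assoc]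
    · rw [Category.assoc, h2, ← Category.assoc, hab]
    · rw [← Category.assoc, hb', Category.assoc, h1', Category.assoc]
    · rw [Category.assoc, h2', ← Category.assoc]

lemma exists_triv (Y : E) (n : ℕ) (X : E) : ∃ t : Tw Y n X, Eff t (𝟙 X) := by
  have h0 : ∀ n, Nonempty (Tw Y n (0 : E)) := by
    intro n
    induction n with
    | zero => exact ⟨.base (𝟙 Y) 0 (conf_id_zero (isZero_zero E) Y)⟩
    | succ n ih =>
      obtain ⟨t⟩ := ih
      exact ⟨.step 0 (𝟙 _) (conf_zero_id (isZero_zero E) _) t⟩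
  match n with
  | 0 => exact ⟨.base _ _ (conf_biprod Y X), biprod.inr, by simp⟩
  | n + 1 =>
    obtain ⟨t⟩ := h0 n
    refine ⟨.step 0 (𝟙 X) (conf_zero_id (isZero_zero E) X) t, ?_⟩
    have := Eff.step_of_lift (hc := conf_zero_id (isZero_zero E) X) (t := t) (𝟙 X)
    simpa using this

theorem vanish_iff (n : ℕ) (X Y : E) : eExtVanish E (n + 1) X Y ↔ V n X Y := by
  constructor
  · intro h
    refine V.of_id fun t => ?_
    obtain ⟨t0, ht0⟩ := exists_triv Y n X
    obtain ⟨s, hs⟩ := t.exists_seq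
    obtain ⟨s0, hs0⟩ := t0.exists_seq
    have h1 := (h s0 s).triv_iff.1 (Eff.congr _ (hs0.eff ht0) (Category.id_comp _))
    exact hs.eff_symm (Eff.congr _ h1 (Category.id_comp _).symm)
  · intro h s t
    obtain ⟨s0, h1, h2⟩ := exists_common (h _ s.st.tw s.x) (h _ t.st.tw t.x)
    exact .trans _ _ _ (.symm _ _ (.rel _ _ h1.hom)) (.rel _ _ h2.hom)

end Sequences

section Main

variable [ExactCatStruct E] [IsExactCat E]

lemma MAdmEpi.defl {ℳ : Set E} {d : ℕ} {X Y : E} {f : X ⟶ Y} (h : MAdmEpi E ℳ d f) :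
    Deflation f := by
  obtain ⟨T, s, hs, e, he⟩ := h
  have := s.iso_bot
  have h1 := ((s.conf 0).precomp_iso e.symm).right_iso (asIso (s.ι 0) ≪≫ s.iso0)
  have h2 : (e.symm.hom ≫ s.π 0) ≫ (asIso (s.ι 0) ≪≫ s.iso0).hom = f := by
    unfold EExtSeq.dd at he
    simp only [Iso.symm_hom, Iso.trans_hom, asIso_hom, Category.assoc]
    rw [← Category.assoc (s.π 0), he]
    simp
  rw [h2] at h1
  exact h1.defl

lemma MAdmMono.infl {ℳ : Set E} {d : ℕ} (hd : 1 ≤ d) {X Y : E} {f : X ⟶ Y}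
    (h : MAdmMono E ℳ d f) : Inflation f := by
  obtain ⟨B, s, hs, e, he⟩ := h
  obtain ⟨d, rfl⟩ : ∃ k, d = k + 1 := ⟨d - 1, by omega⟩
  have := (s.conf (d + 1)).isIso_of_zero (s.Z_zero _ (by omega))
  have h1 : Conf f (e.inv ≫ s.π d) := by
    refine (s.conf d).of_iso ((asIso (s.π (d + 1))).symm ≪≫ s.isoTop) e (Iso.refl _) ?_ (by simp)
    unfold EExtSeq.dd at he
    have h2 : s.ι (d + 1) = inv (s.π (d + 1)) ≫ s.isoTop.hom ≫ f ≫ e.inv := by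
      rw [← he]; simp
    rw [h2]
    simp
  exact h1.infl

lemma EProj.mproj {P : E} (h : EProj E P) (ℳ : Set E) (d : ℕ) : MProj E ℳ d P :=
  fun _ _ f hf g => h f hf.defl g

lemma EInj.minj {P : E} (h : EInj E P) (ℳ : Set E) {d : ℕ} (hd : 1 ≤ d) : MInj E ℳ d P :=
  fun _ _ f hf g => h f (hf.infl hd) g

lemma EProj.retract {P Q : E} (h : EProj E Q) (i : P ⟶ Q) (r : Q ⟶ P) (hir : i ≫ r = 𝟙 P) :
    EProj E P := by
  intro X Y f hf g
  obtain ⟨k, hk⟩ := h f hf (r ≫ g)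
  exact ⟨i ≫ k, by rw [Category.assoc, hk, ← Category.assoc, hir, Category.id_comp]⟩

lemma EInj.retract {P Q : E} (h : EInj E Q) (i : P ⟶ Q) (r : Q ⟶ P) (hir : i ≫ r = 𝟙 P) :
    EInj E P := by
  intro X Y f hf g
  obtain ⟨k, hk⟩ := h f hf (g ≫ i)
  exact ⟨k ≫ r, by rw [← Category.assoc, hk, Category.assoc, hir, Category.comp_id]⟩

variable [HasZeroObject E]

/-- The syzygy `Z 0` is isomorphic to the end term. -/
noncomputable def EExtSeq.isoX {n : ℕ} {X Y : E} (s : EExtSeq E n X Y) : s.Z 0 ≅ X :=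
  have := s.iso_bot
  asIso (s.ι 0) ≪≫ s.iso0

/-- The syzygy `Z n` is isomorphic to the other end term. -/
noncomputable def EExtSeq.isoY {n : ℕ} {X Y : E} (s : EExtSeq E n X Y) : s.Z n ≅ Y :=
  have := s.isIso_pi_top
  (asIso (s.π n)).symm ≪≫ s.isoTop

lemma EExtSeq.shift_up {n : ℕ} {X T : E} (s : EExtSeq E n X T) {Y : E} {k j : ℕ}
    (hp : ∀ i, 1 ≤ i → i ≤ j → EProj E (s.ob i)) (h : V k (s.Z j) Y) : V (k + j) X Y := by
  have : ∀ j k, (∀ i, 1 ≤ i → i ≤ j → EProj E (s.ob i)) → V k (s.Z j) Y → V (k + j) (s.Z 0) Y := by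
    intro j
    induction j with
    | zero => intro k _ h; exact h
    | succ j ih =>
      intro k hp h
      have := ih (k + 1) (fun i h1 h2 => hp i h1 (by omega))
        (h.succ_of_proj (s.conf j) (hp (j + 1) (by omega) le_rfl))
      rwa [show k + (j + 1) = k + 1 + j by omega]
  exact (this j k hp h).of_iso s.isoX

lemma EExtSeq.shift_down {n : ℕ} {X T : E} (s : EExtSeq E n X T) {Y : E} {k j : ℕ}
    (hp : ∀ i, 1 ≤ i → i ≤ j → EProj E (s.ob i)) (h : V (k + j) X Y) : V k (s.Z j) Y := by
  have : ∀ j k, (∀ i, 1 ≤ i → i ≤ j → EProj E (s.ob i)) → V (k + j) (s.Z 0) Y → V k (s.Z j) Y := by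
    intro j
    induction j with
    | zero => intro k _ h; exact h
    | succ j ih =>
      intro k hp h
      rw [show k + (j + 1) = k + 1 + j by omega] at h
      have := ih (k + 1) (fun i h1 h2 => hp i h1 (by omega)) h
      exact this.of_succ_of_proj (s.conf j) (hp (j + 1) (by omega) le_rfl)
  exact this j k hp (h.of_iso s.isoX.symm)

variable [HasBinaryBiproducts E]

section DCT

variable {ℳ : Set E} {d : ℕ}

lemma IsDCT.mem_left (hM : IsDCT E ℳ d) (X : E) :
    X ∈ ℳ ↔ ∀ k, k + 1 < d → ∀ M ∈ ℳ, V k X M := by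
  constructor
  · intro h k hk M hMm
    rw [hM.eq_left_perp] at h
    exact (vanish_iff _ _ _).1 (h (k + 1) (by omega) hk M hMm)
  · intro h
    rw [hM.eq_left_perp]
    intro i hi hid M hMm
    obtain ⟨k, rfl⟩ : ∃ k, i = k + 1 := ⟨i - 1, by omega⟩
    exact (vanish_iff _ _ _).2 (h k hid M hMm)

lemma IsDCT.mem_right (hM : IsDCT E ℳ d) (X : E) :
    X ∈ ℳ ↔ ∀ k, k + 1 < d → ∀ M ∈ ℳ, V k M X := by
  constructor
  · intro h k hk M hMm
    rw [hM.eq_right_perp] at h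
    exact (vanish_iff _ _ _).1 (h (k + 1) (by omega) hk M hMm)
  · intro h
    rw [hM.eq_right_perp]
    intro i hi hid M hMm
    obtain ⟨k, rfl⟩ : ∃ k, i = k + 1 := ⟨i - 1, by omega⟩
    exact (vanish_iff _ _ _).2 (h k hid M hMm)

lemma IsDCT.biprod_mem (hM : IsDCT E ℳ d) {A B : E} (hA : A ∈ ℳ) (hB : B ∈ ℳ) :
    (A ⊞ B) ∈ ℳ := by
  rw [hM.mem_left]
  intro k hk M hMm
  exact V.biprod ((hM.mem_left A).1 hA k hk M hMm) ((hM.mem_left B).1 hB k hk M hMm)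

lemma IsDCT.proj_mem (hM : IsDCT E ℳ d) {P : E} (hP : EProj E P) : P ∈ ℳ := by
  rw [hM.mem_left]
  intro k _ M _
  exact hP.V k M

/-- Finite resolutions by objects of `ℳ`. -/
def ResM (ℳ : Set E) : ℕ → E → Prop
  | 0, X => X ∈ ℳ
  | k + 1, X => ∃ (K M : E) (i : K ⟶ M) (p : M ⟶ X), M ∈ ℳ ∧ Conf i p ∧ ResM ℳ k K

lemma IsDCT.approx (hM : IsDCT E ℳ d) (X : E) : ∃ (K M : E) (i : K ⟶ M) (p : M ⟶ X),
    M ∈ ℳ ∧ Conf i p ∧ ∀ M' ∈ ℳ, ∀ g : M' ⟶ X, ∃ h : M' ⟶ M, h ≫ p = g := by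
  obtain ⟨M1, hM1, f1, hf1⟩ := hM.contravariantly_finite X
  obtain ⟨M2, hM2, f2, hf2⟩ := hM.generating X
  obtain ⟨K, i, hc⟩ := (deflation_desc f1 hf2).conf
  refine ⟨K, M1 ⊞ M2, i, _, hM.biprod_mem hM1 hM2, hc, ?_⟩
  intro M' hM' g
  obtain ⟨h, hh⟩ := hf1 M' hM' g
  exact ⟨h ≫ biprod.inl, by simp [hh]⟩

lemma IsDCT.res_aux (hM : IsDCT E ℳ d) : ∀ k j, j + k + 1 = d → ∀ X,
    (∀ i, i < j → ∀ M ∈ ℳ, V i M X) → ResM ℳ k X := by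
  intro k
  induction k with
  | zero =>
    intro j hj X hX
    change X ∈ ℳ
    rw [hM.mem_right]
    intro i hi M hMm
    exact hX i (by omega) M hMm
  | succ k ih =>
    intro j hj X hX
    obtain ⟨K, M, i, p, hMm, hc, hl⟩ := hM.approx X
    refine ⟨K, M, i, p, hMm, hc, ih (j + 1) (by omega) K ?_⟩
    intro a ha M' hM'
    match a, ha with
    | 0, _ => exact V.cov_zero hc ((hM.mem_right M).1 hMm 0 (by omega) M' hM') (hl M' hM')
    | a + 1, ha =>
      exact V.cov_succ hc ((hM.mem_right M).1 hMm (a + 1) (by omega) M' hM')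
        (hX a (by omega) M' hM')

lemma IsDCT.res (hM : IsDCT E ℳ d) (hd : 1 ≤ d) (X : E) : ResM ℳ (d - 1) X :=
  hM.res_aux (d - 1) 0 (by omega) X (fun i hi => by omega)

lemma ResM.seq {k : ℕ} : ∀ {X : E}, ResM ℳ k X → ∃ (T : E) (s : EExtSeq E k X T),
    ∀ i, 1 ≤ i → i ≤ k + 1 → s.ob i ∈ ℳ := by
  induction k with
  | zero =>
    intro X hX
    refine ⟨X, EExtSeq.nil X, ?_⟩
    intro i h1 h2
    obtain rfl : i = 1 := by omega
    exact hX
  | succ k ih =>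
    rintro X ⟨K, M, i, p, hMm, hc, hK⟩
    obtain ⟨T, s, hs⟩ := ih hK
    refine ⟨T, EExtSeq.cons hc s, ?_⟩
    intro i h1 h2
    match i, h1, h2 with
    | 1, _, _ => exact hMm
    | i + 2, _, h2 => exact hs (i + 1) (by omega) (by omega)

lemma IsDCT.admEpi (hM : IsDCT E ℳ d) (hd : 1 ≤ d) {M N : E} (hMm : M ∈ ℳ) (hN : N ∈ ℳ)
    {f : M ⟶ N} (hf : Deflation f) : MAdmEpi E ℳ d f := by
  obtain ⟨K, i, hc⟩ := hf.conf
  obtain ⟨T, s, hs⟩ := (hM.res hd K).seq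
  obtain ⟨d, rfl⟩ : ∃ k, d = k + 1 := ⟨d - 1, by omega⟩
  refine ⟨T, EExtSeq.cons hc s, ?_, Iso.refl _, ?_⟩
  · intro a ha
    match a, ha with
    | 0, _ => exact hN
    | 1, _ => exact hMm
    | a + 2, ha => exact hs (a + 1) (by omega) (by simp; omega)
  · change f ≫ 𝟙 N = 𝟙 M ≫ f ≫ 𝟙 N
    simp

lemma IsDCT.eproj (hM : IsDCT E ℳ d) (hd : 1 ≤ d) {P : E} (hPm : P ∈ ℳ) (hP : MProj E ℳ d P) :
    EProj E P := by
  intro X Y f hf g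
  obtain ⟨K, i, hc⟩ := hf.conf
  obtain ⟨W, i', p', q, hc', _, hpb⟩ := hc.pull g
  obtain ⟨M, hMm, m, hm⟩ := hM.generating W
  obtain ⟨h, hh⟩ := hP (m ≫ p')
    (hM.admEpi hd hMm hPm (IsExactCat.comp_deflation m p' hm hc'.defl)) (𝟙 P)
  refine ⟨h ≫ m ≫ q, ?_⟩
  rw [Category.assoc, Category.assoc, hpb.w, ← Category.assoc m, ← Category.assoc, hh,
    Category.id_comp]

lemma seq_admMono {X B : E} (s : EExtSeq E d B X) (hs : ∀ i, i ≤ d + 1 → s.ob i ∈ ℳ) :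
    MAdmMono E ℳ d (s.isoTop.inv ≫ s.dd d) :=
  ⟨B, s, hs, Iso.refl _, by simp⟩

lemma seq_admEpi {X T : E} (s : EExtSeq E d X T) (hs : ∀ i, i ≤ d + 1 → s.ob i ∈ ℳ) :
    MAdmEpi E ℳ d (s.dd 0 ≫ s.iso0.hom) :=
  ⟨T, s, hs, Iso.refl _, by simp⟩

lemma ResM.V {P : E} (hP : EnoughP E) (h : ∀ k, k < d → ∀ M ∈ ℳ, V k M P) :
    ∀ k, k < d → ∀ X, ResM ℳ k X → V k X P := by
  intro k
  induction k with
  | zero => intro hk X hX; exact h 0 hk X hX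
  | succ k ih =>
    rintro hk X ⟨K, M, i, p, hMm, hc, hK⟩
    exact V.third hP hc (ih (by omega) K hK) (h (k + 1) hk M hMm)

theorem forward (hM : IsDCT E ℳ d) (hd : 1 ≤ d) (h : MFrobenius E ℳ d) :
    EFrobenius E ∧ ∀ k, ¬ d ∣ k + 1 → ∀ X ∈ ℳ, ∀ Y ∈ ℳ, V k X Y := by
  obtain ⟨hp, hi, hpi⟩ := h
  have hres : ∀ M ∈ ℳ, ∃ (T : E) (s : EExtSeq E d M T), (∀ i, i ≤ d + 1 → s.ob i ∈ ℳ) ∧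
      ∀ i, 1 ≤ i → i ≤ d → EProj E (s.ob i) := by
    intro M hMm
    obtain ⟨T, s, hs, hs'⟩ := hp M hMm
    exact ⟨T, s, hs, fun i h1 h2 => hM.eproj hd (hs i (by omega)) (hs' i h1 h2)⟩
  -- enough projectives
  have hEP : ∀ X : E, ∃ P : E, EProj E P ∧ ∃ p : P ⟶ X, Deflation p := by
    intro X
    obtain ⟨M, hMm, f, hf⟩ := hM.generating X
    obtain ⟨T, s, hs, hs'⟩ := hres M hMm
    exact ⟨s.ob 1, hs' 1 le_rfl hd, (s.dd 0 ≫ s.iso0.hom) ≫ f,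
      IsExactCat.comp_deflation _ _ (seq_admEpi s hs).defl hf⟩
  -- enough projectives on the other side
  have hEJ : ∀ X : E, ∃ P : E, EProj E P ∧ ∃ p : X ⟶ P, Inflation p := by
    intro X
    obtain ⟨M, hMm, f, hf⟩ := hM.cogenerating X
    obtain ⟨T, s, hs, hs'⟩ := hi M hMm
    refine ⟨s.ob d, hM.eproj hd (hs d (by omega)) ((hpi _ (hs d (by omega))).2 (hs' d hd le_rfl)),
      f ≫ s.isoTop.inv ≫ s.dd d, IsExactCat.comp_inflation _ _ hf ((seq_admMono s hs).infl hd)⟩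
  have hPI : ∀ P : E, EProj E P → EInj E P := by
    intro P hP
    have hPm := hM.proj_mem hP
    have hPinj : MInj E ℳ d P := (hpi P hPm).1 (hP.mproj ℳ d)
    have h1 : ∀ M ∈ ℳ, V (d - 1) M P := by
      intro M hMm
      obtain ⟨T, s, hs, hs'⟩ := hres M hMm
      have h2 : V 0 (s.Z (d - 1)) P := by
        obtain ⟨d, rfl⟩ : ∃ k, d = k + 1 := ⟨d - 1, by omega⟩
        refine V.zero_of_ext (s.conf d) ((hs' (d + 1) (by omega) le_rfl).V _ _) ?_
        intro f
        obtain ⟨g, hg⟩ := hPinj _ (seq_admMono s hs) (s.isoTop.inv ≫ s.π (d + 1) ≫ f)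
        refine ⟨g, ?_⟩
        have := (s.conf (d + 1)).epi
        rw [Category.assoc, cancel_epi] at hg
        unfold EExtSeq.dd at hg
        rw [Category.assoc, cancel_epi] at hg
        exact hg
      have := s.shift_up (fun i h1 h2 => hs' i h1 (by omega)) h2
      rwa [Nat.zero_add] at this
    have h2 : ∀ k, k < d → ∀ M ∈ ℳ, V k M P := by
      intro k hk M hMm
      by_cases hkd : k + 1 < d
      · exact (hM.mem_left M).1 hMm k hkd P hPm
      · obtain rfl : k = d - 1 := by omega
        exact h1 M hMm
    have h3 : ∀ X, V (d - 1) X P := fun X =>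
      ResM.V hEP h2 (d - 1) (by omega) X (hM.res hd X)
    have h4 : ∀ k, (∀ X, V k X P) → ∀ X, V 0 X P := by
      intro k
      induction k with
      | zero => exact fun h => h
      | succ k ih =>
        intro h
        apply ih
        intro X
        obtain ⟨J, hJ, j, hj⟩ := hEJ X
        obtain ⟨C, q, hc⟩ := hj.conf
        exact (h C).of_succ_of_proj hc hJ
    intro X Y f hf g
    obtain ⟨C, q, hc⟩ := hf.conf
    exact (h4 _ h3 C).ext_of_zero hc g
  refine ⟨⟨hEP, ?_, ?_⟩, ?_⟩
  · intro X
    obtain ⟨J, hJ, j, hj⟩ := hEJ X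
    exact ⟨J, hPI J hJ, j, hj⟩
  · intro P
    refine ⟨hPI P, fun hP => ?_⟩
    obtain ⟨J, hJ, j, hj⟩ := hEJ P
    obtain ⟨r, hr⟩ := hP j hj (𝟙 P)
    exact hJ.retract j r hr
  · intro k
    induction k using Nat.strong_induction_on with
    | _ k ih =>
      intro hk X hX Y hY
      by_cases hkd : k + 1 < d
      · exact (hM.mem_left X).1 hX k hkd Y hY
      · obtain ⟨T, s, hs, hs'⟩ := hres X hX
        have hne : k + 1 ≠ d := fun h => hk (by rw [h])
        obtain ⟨a, rfl⟩ : ∃ a, k = a + d := ⟨k - d, by omega⟩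
        have hT : T ∈ ℳ := hM.iso_closed _ _ s.isoTop (hs (d + 1) le_rfl)
        have := ih a (by omega) (fun h => hk (by
          rw [show a + d + 1 = a + 1 + d by omega]; exact (Nat.dvd_add_self_right).2 h)) T hT Y hY
        exact s.shift_up hs' (this.of_iso s.isoY.symm)

lemma exists_proj_res (hP : EnoughP E) (n : ℕ) : ∀ X : E, ∃ (T : E) (s : EExtSeq E n X T),
    ∀ i, 1 ≤ i → i ≤ n → EProj E (s.ob i) := by
  induction n with
  | zero => exact fun X => ⟨X, EExtSeq.nil X, fun i h1 h2 => by omega⟩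
  | succ n ih =>
    intro X
    obtain ⟨L, Q, j, q, hQ, hc⟩ := hP.conf X
    obtain ⟨T, s, hs⟩ := ih L
    refine ⟨T, EExtSeq.cons hc s, ?_⟩
    intro i h1 h2
    match i, h1, h2 with
    | 1, _, _ => exact hQ
    | i + 2, _, h2 => exact hs (i + 1) (by omega) (by omega)

lemma exists_inj_res (hP : EnoughP E) (hI : ∀ X : E, ∃ I : E, EInj E I ∧ ∃ i : X ⟶ I, Inflation i)
    (M : E) (n : ℕ) : ∃ (B : E) (s : EExtSeq E n B M),
    (∀ i, 1 ≤ i → i ≤ n → EInj E (s.ob i)) ∧ ∀ k X, V (k + n) X M → V k X B := by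
  induction n with
  | zero => exact ⟨M, EExtSeq.nil M, fun i h1 h2 => by omega, fun k X h => h⟩
  | succ n ih =>
    obtain ⟨B, s, hs, hB⟩ := ih
    obtain ⟨I, hI', i, hi⟩ := hI B
    obtain ⟨C, p, hc⟩ := hi.conf
    refine ⟨C, EExtSeq.cons hc s, ?_, ?_⟩
    · intro i h1 h2
      match i, h1, h2 with
      | 1, _, _ => exact hI'
      | i + 2, _, h2 => exact hs (i + 1) (by omega) (by omega)
    · intro k X h
      rw [show k + (n + 1) = k + 1 + n by omega] at h
      exact V.inj_shift hP hc hI' k (hB _ _ h)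

theorem backward (hM : IsDCT E ℳ d) (hd : 1 ≤ d) (h : EFrobenius E)
    (hz : ∀ k, ¬ d ∣ k + 1 → ∀ X ∈ ℳ, ∀ Y ∈ ℳ, V k X Y) : MFrobenius E ℳ d := by
  obtain ⟨hEP, hEI, hPI⟩ := h
  have hnd : ∀ k, k + 1 < d → ¬ d ∣ k + d + 1 := by
    intro k hk hdvd
    rw [show k + d + 1 = k + 1 + d by omega] at hdvd
    have := Nat.le_of_dvd (by omega) ((Nat.dvd_add_self_right).1 hdvd)
    omega
  have h1 : ∀ M ∈ ℳ, ∃ (T : E) (s : EExtSeq E d M T), (∀ i, i ≤ d + 1 → s.ob i ∈ ℳ) ∧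
      ∀ i, 1 ≤ i → i ≤ d → EProj E (s.ob i) := by
    intro M hMm
    obtain ⟨T, s, hs⟩ := exists_proj_res hEP d M
    have hT : T ∈ ℳ := by
      rw [hM.mem_left]
      intro k hk N hN
      exact (s.shift_down hs (hz _ (hnd k hk) M hMm N hN)).of_iso s.isoY
    refine ⟨T, s, ?_, hs⟩
    intro i hi
    by_cases h0 : i = 0
    · subst h0
      exact hM.iso_closed _ _ s.iso0.symm hMm
    by_cases h2 : i = d + 1
    · subst h2
      exact hM.iso_closed _ _ s.isoTop.symm hT
    exact hM.proj_mem (hs i (by omega) (by omega))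
  have h2 : ∀ M ∈ ℳ, ∃ (B : E) (s : EExtSeq E d B M), (∀ i, i ≤ d + 1 → s.ob i ∈ ℳ) ∧
      ∀ i, 1 ≤ i → i ≤ d → EInj E (s.ob i) := by
    intro M hMm
    obtain ⟨B, s, hs, hB⟩ := exists_inj_res hEP hEI M d
    have hT : B ∈ ℳ := by
      rw [hM.mem_right]
      intro k hk N hN
      exact hB k N (hz _ (hnd k hk) N hN M hMm)
    refine ⟨B, s, ?_, hs⟩
    intro i hi
    by_cases h0 : i = 0
    · subst h0
      exact hM.iso_closed _ _ s.iso0.symm hT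
    by_cases h2 : i = d + 1
    · subst h2
      exact hM.iso_closed _ _ s.isoTop.symm hMm
    exact hM.proj_mem ((hPI _).2 (hs i (by omega) (by omega)))
  refine ⟨?_, ?_, ?_⟩
  · intro M hMm
    obtain ⟨T, s, hs, hs'⟩ := h1 M hMm
    exact ⟨T, s, hs, fun i a b => (hs' i a b).mproj _ _⟩
  · intro M hMm
    obtain ⟨T, s, hs, hs'⟩ := h2 M hMm
    exact ⟨T, s, hs, fun i a b => (hs' i a b).minj _ hd⟩
  · intro P hPm
    constructor
    · intro hP
      obtain ⟨T, s, hs, hs'⟩ := h1 P hPm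
      obtain ⟨r, hr⟩ := hP _ (seq_admEpi s hs) (𝟙 P)
      exact ((hPI P).1 ((hs' 1 le_rfl hd).retract _ _ hr)).minj _ hd
    · intro hP
      obtain ⟨T, s, hs, hs'⟩ := h2 P hPm
      obtain ⟨r, hr⟩ := hP _ (seq_admMono s hs) (𝟙 P)
      exact ((hPI P).2 ((hs' d hd le_rfl).retract _ _ hr)).mproj _ _

end DCT

end Main

/-- `ℳ` is a Frobenius `d`-exact category if and only if `E` is a Frobenius
exact category and `ℳ` is a `dℤ`-cluster tilting subcategory of `E`. -/
theorem frobenius_dexact_iff_frobenius_and_dZ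
    (E : Type u) [Category.{v} E] [Preadditive E] [HasZeroObject E] [HasBinaryBiproducts E]
    [ExactCatStruct E] [IsExactCat E]
    (hwic : WeaklyIdemComplete E)
    (d : ℕ) (hd : 1 ≤ d) (ℳ : Set E) (hM : IsDCT E ℳ d) :
    MFrobenius E ℳ d ↔
      (EFrobenius E ∧ ∀ i : ℕ, 0 < i → ¬ (d ∣ i) → ∀ X ∈ ℳ, ∀ Y ∈ ℳ, eExtVanish E i X Y) := by
  have e : (∀ i : ℕ, 0 < i → ¬ (d ∣ i) → ∀ X ∈ ℳ, ∀ Y ∈ ℳ, eExtVanish E i X Y) ↔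
      ∀ k, ¬ d ∣ k + 1 → ∀ X ∈ ℳ, ∀ Y ∈ ℳ, V k X Y := by
    constructor
    · intro h k hk X hX Y hY
      exact (vanish_iff _ _ _).1 (h (k + 1) (by omega) hk X hX Y hY)
    · intro h i hi hid X hX Y hY
      obtain ⟨k, rfl⟩ : ∃ k, i = k + 1 := ⟨i - 1, by omega⟩
      exact (vanish_iff _ _ _).2 (h k hid X hX Y hY)
  rw [e]
  exact ⟨forward hM hd, fun h => backward hM hd h.1 h.2⟩
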